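/- Let H₁ be the self-adjoint operator −d²/dx² + V on L²(0,∞) with Dirichlet boundary condition at 0, where V is limit point at +∞, and let φ be a nonzero solution of −φ'' + Vφ = iφ on (0,∞) with φ ∈ L² near +∞. Then the restriction of φ to [0,∞) is a cyclic vector for H₁. -/

import Mathlib

open MeasureTheory

/-- `u` (with derivative `u'`) solves `-u'' + V u = z u + f` on the set `s`, in integrated
form, anchored at the base point `x₀`. -/
def IsSolOnInhom (V : ℝ → ℝ) (z : ℂ) (f : ℝ → ℂ) (u u' : ℝ → ℂ) (s : Set ℝ) (x₀ : ℝ) : Prop :=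
  (∀ x ∈ s, u x = u x₀ + ∫ t in x₀..x, u' t) ∧
  (∀ x ∈ s, u' x = u' x₀ + ∫ t in x₀..x, (((V t : ℂ) - z) * u t - f t))

/-- `u` solves the homogeneous equation `-u'' + V u = z u` on `s`. -/
def IsSolOn (V : ℝ → ℝ) (z : ℂ) (u u' : ℝ → ℂ) (s : Set ℝ) (x₀ : ℝ) : Prop :=
  IsSolOnInhom V z (fun _ => 0) u u' s x₀

/-- `V` is limit point at `+∞`. -/
def LimitPointAtTop (V : ℝ → ℝ) : Prop :=
  ∀ z : ℂ, z.im ≠ 0 → ∀ u u' v v' : ℝ → ℂ,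
    IsSolOn V z u u' (Set.Ioi 0) 1 → IsSolOn V z v v' (Set.Ioi 0) 1 →
    IntegrableOn (fun x => ‖u x‖ ^ 2) (Set.Ioi 1) volume →
    IntegrableOn (fun x => ‖v x‖ ^ 2) (Set.Ioi 1) volume →
    ∃ c d : ℂ, (c, d) ≠ 0 ∧ ∀ x ∈ Set.Ioi (0 : ℝ), c * u x + d * v x = 0

/-- `Rz z` is the resolvent `(H₁ − z)⁻¹` of the half-line Dirichlet Schrödinger operator
`H₁ = −d²/dx² + V` on `L²(0,∞)`, for every nonreal `z`. -/
def IsHalfLineResolventFamily (V : ℝ → ℝ)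
    (Rz : ℂ → (Lp ℂ 2 ((volume : Measure ℝ).restrict (Set.Ioi 0)) →L[ℂ]
      Lp ℂ 2 ((volume : Measure ℝ).restrict (Set.Ioi 0)))) : Prop :=
  ∀ z : ℂ, z.im ≠ 0 → ∀ f, ∃ u u' : ℝ → ℂ,
    (Rz z f : ℝ → ℂ) =ᵐ[(volume : Measure ℝ).restrict (Set.Ioi 0)] u ∧
    IsSolOnInhom V z (fun t => f t) u u' (Set.Ioi 0) 1 ∧
    Filter.Tendsto u (nhdsWithin 0 (Set.Ioi 0)) (nhds 0) ∧
    IntegrableOn (fun x => ‖u x‖ ^ 2) (Set.Ioi 0) volume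


theorem prod_rule_real {f g : ℝ → ℝ} {a b : ℝ} (hf : IntervalIntegrable f volume a b)
    (hg : IntervalIntegrable g volume a b) :
    ∫ x in a..b, (f x * (∫ t in a..x, g t) + (∫ t in a..x, f t) * g x)
      = (∫ t in a..b, f t) * (∫ t in a..b, g t) := by
  have h := AbsolutelyContinuousOnInterval.integral_deriv_mul_eq_sub
    (hf.absolutelyContinuousOnInterval_intervalIntegral (c := a) (by simp))
    (hg.absolutelyContinuousOnInterval_intervalIntegral (c := a) (by simp))
  simp only [intervalIntegral.integral_same, mul_zero, sub_zero] at h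
  rw [← h]
  apply intervalIntegral.integral_congr_ae
  filter_upwards [hf.ae_hasDerivAt_integral, hg.ae_hasDerivAt_integral] with x h1 h2 hx
  have hx' := Set.uIoc_subset_uIcc hx
  rw [(h1 hx' a (by simp)).deriv, (h2 hx' a (by simp)).deriv]

theorem prod_rule0 {f g : ℝ → ℂ} {a b : ℝ} (hf : IntervalIntegrable f volume a b)
    (hg : IntervalIntegrable g volume a b) :
    ∫ x in a..b, (f x * (∫ t in a..x, g t) + (∫ t in a..x, f t) * g x)
      = (∫ t in a..b, f t) * (∫ t in a..b, g t) := by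
  have hfr : IntervalIntegrable (fun x => (f x).re) volume a b := ⟨hf.1.re, hf.2.re⟩
  have hfi : IntervalIntegrable (fun x => (f x).im) volume a b := ⟨hf.1.im, hf.2.im⟩
  have hgr : IntervalIntegrable (fun x => (g x).re) volume a b := ⟨hg.1.re, hg.2.re⟩
  have hgi : IntervalIntegrable (fun x => (g x).im) volume a b := ⟨hg.1.im, hg.2.im⟩
  have key : ∀ {h : ℝ → ℂ}, IntervalIntegrable h volume a b → ∀ x ∈ Set.uIcc a b,
      ∫ t in a..x, h t = ((∫ t in a..x, (h t).re : ℝ) : ℂ) + ((∫ t in a..x, (h t).im : ℝ) : ℂ) * Complex.I := by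
    intro h hh x hx
    have hh' : IntervalIntegrable h volume a x := hh.mono_set (Set.uIcc_subset_uIcc (by simp) hx)
    have e1 := (Complex.reCLM.intervalIntegral_comp_comm hh')
    have e2 := (Complex.imCLM.intervalIntegral_comp_comm hh')
    simp only [Complex.reCLM_apply, Complex.imCLM_apply] at e1 e2
    rw [e1, e2, Complex.re_add_im]
  have int : ∀ {p q : ℝ → ℝ}, IntervalIntegrable p volume a b → IntervalIntegrable q volume a b →
      IntervalIntegrable (fun x => p x * (∫ t in a..x, q t) + (∫ t in a..x, p t) * q x) volume a b := by
    intro p q hp hq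
    have c1 := (hp.absolutelyContinuousOnInterval_intervalIntegral (c := a) (by simp)).continuousOn
    have c2 := (hq.absolutelyContinuousOnInterval_intervalIntegral (c := a) (by simp)).continuousOn
    exact (hp.mul_continuousOn c2).add (hq.continuousOn_mul c1)
  rw [key hf b (by simp), key hg b (by simp)]
  have e : ∀ x ∈ Set.uIcc a b, (f x * (∫ t in a..x, g t) + (∫ t in a..x, f t) * g x) =
     (((( (f x).re * (∫ t in a..x, (g t).re) + (∫ t in a..x, (f t).re) * (g x).re) - ((f x).im * (∫ t in a..x, (g t).im) + (∫ t in a..x, (f t).im) * (g x).im) : ℝ)) : ℂ) + 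
     (((( (f x).re * (∫ t in a..x, (g t).im) + (∫ t in a..x, (f t).re) * (g x).im) + ((f x).im * (∫ t in a..x, (g t).re) + (∫ t in a..x, (f t).im) * (g x).re) : ℝ)) : ℂ) * Complex.I := by
    intro x hx
    rw [key hf x hx, key hg x hx]
    conv_lhs => rw [← Complex.re_add_im (f x), ← Complex.re_add_im (g x)]
    push_cast
    linear_combination (((f x).im : ℂ) * ((∫ t in a..x, (g t).im : ℝ) : ℂ) + ((∫ t in a..x, (f t).im : ℝ) : ℂ) * ((g x).im : ℂ)) * Complex.I_sq
  rw [intervalIntegral.integral_congr e, intervalIntegral.integral_add, intervalIntegral.integral_mul_const,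
    intervalIntegral.integral_ofReal, intervalIntegral.integral_ofReal,
    intervalIntegral.integral_sub (int hfr hgr) (int hfi hgi), intervalIntegral.integral_add (int hfr hgi) (int hfi hgr),
    prod_rule_real hfr hgr, prod_rule_real hfr hgi, prod_rule_real hfi hgr, prod_rule_real hfi hgi]
  · push_cast
    linear_combination (-((∫ t in a..b, (f t).im : ℝ) : ℂ) * ((∫ t in a..b, (g t).im : ℝ) : ℂ)) * Complex.I_sq
  · have := (int hfr hgr).sub (int hfi hgi)
    exact ⟨this.1.ofReal, this.2.ofReal⟩
  · have := (int hfr hgi).add (int hfi hgr)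
    exact IntervalIntegrable.mul_const ⟨this.1.ofReal, this.2.ofReal⟩ _
theorem prod_rule {f g F G : ℝ → ℂ} {a b : ℝ} (hf : IntervalIntegrable f volume a b)
    (hg : IntervalIntegrable g volume a b)
    (hF : ∀ x ∈ Set.uIcc a b, F x = F a + ∫ t in a..x, f t)
    (hG : ∀ x ∈ Set.uIcc a b, G x = G a + ∫ t in a..x, g t) :
    F b * G b = F a * G a + ∫ x in a..b, (f x * G x + F x * g x) := by
  have h0 := prod_rule0 hf hg
  have c1 := intervalIntegral.continuousOn_primitive_interval' hf (a := a) (by simp)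
  have c2 := intervalIntegral.continuousOn_primitive_interval' hg (a := a) (by simp)
  have e : ∀ x ∈ Set.uIcc a b, f x * G x + F x * g x =
      (f x * (∫ t in a..x, g t) + (∫ t in a..x, f t) * g x) + (f x * G a + F a * g x) := by
    intro x hx
    rw [hF x hx, hG x hx]; ring
  rw [intervalIntegral.integral_congr e, intervalIntegral.integral_add
    ((hf.mul_continuousOn c2).add (hg.continuousOn_mul c1)) ((hf.mul_const _).add (hg.const_mul _)), h0,
    intervalIntegral.integral_add (hf.mul_const _) (hg.const_mul _),
    intervalIntegral.integral_mul_const, intervalIntegral.integral_const_mul, hF b (by simp), hG b (by simp)]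
  ring

theorem contOn_Ico {u : ℝ → ℂ} {a b : ℝ} (h : ∀ y ∈ Set.Ico a b, ContinuousOn u (Set.Icc a y)) :
    ContinuousOn u (Set.Ico a b) := by
  intro x hx
  have hy : (x + b) / 2 ∈ Set.Ico a b := ⟨by linarith [hx.1, hx.2], by linarith [hx.2]⟩
  refine (h _ hy x ⟨hx.1, by linarith [hx.2]⟩).mono_of_mem_nhdsWithin ?_
  have : Set.Iio ((x + b) / 2) ∈ nhds x := Iio_mem_nhds (by linarith [hx.2])
  filter_upwards [mem_nhdsWithin_of_mem_nhds this, self_mem_nhdsWithin] with t ht ht2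
  exact ⟨ht2.1, le_of_lt ht⟩

theorem contOn_of_prim {u v : ℝ → ℂ} {a y : ℝ} (hay : a ≤ y) (hv : IntervalIntegrable v volume a y)
    (h : ∀ x ∈ Set.Icc a y, u x = u a + ∫ t in a..x, v t) : ContinuousOn u (Set.Icc a y) := by
  have c1 := intervalIntegral.continuousOn_primitive_interval' hv (a := a) (by simp)
  rw [Set.uIcc_of_le hay] at c1
  exact (continuousOn_const.add c1).congr h

theorem bdd_step {w f u u' : ℝ → ℂ} {a b : ℝ} (hab : a < b) (hw : IntervalIntegrable w volume a b)
    (hf : IntervalIntegrable f volume a b)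
    (h1 : ∀ x ∈ Set.Ico a b, u x = u a + ∫ t in a..x, u' t)
    (h2 : ∀ x ∈ Set.Ico a b, u' x = u' a + ∫ t in a..x, (w t * u t - f t))
    (i1 : ∀ x ∈ Set.Ico a b, IntervalIntegrable u' volume a x)
    (i2 : ∀ x ∈ Set.Ico a b, IntervalIntegrable (fun t => w t * u t - f t) volume a x) :
    ContinuousOn u (Set.Ico a b) ∧ ContinuousOn u' (Set.Ico a b) ∧
    ∃ M, ∀ x ∈ Set.Ico a b, ‖u x‖ ≤ M ∧ ‖u' x‖ ≤ M := by
  have cu : ContinuousOn u (Set.Ico a b) := contOn_Ico fun y hy =>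
    contOn_of_prim hy.1 (i1 y hy) fun x hx => h1 x ⟨hx.1, hx.2.trans_lt hy.2⟩
  have cu' : ContinuousOn u' (Set.Ico a b) := contOn_Ico fun y hy =>
    contOn_of_prim hy.1 (i2 y hy) fun x hx => h2 x ⟨hx.1, hx.2.trans_lt hy.2⟩
  refine ⟨cu, cu', ?_⟩
  have hp : IntervalIntegrable (fun t => 1 + ‖w t‖) volume a b :=
    intervalIntegrable_const.add hw.norm
  have cP := intervalIntegral.continuousOn_primitive_interval' hp (a := b) (by simp)
  rw [Set.uIcc_of_le hab.le] at cP
  obtain ⟨c, hc, hcs⟩ : ∃ c ∈ Set.Ico a b, ∫ t in c..b, (1 + ‖w t‖) ≤ 1 / 2 := by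
    have h3 := cP b (Set.right_mem_Icc.2 hab.le)
    have h4 : Filter.Tendsto (fun x => ∫ t in b..x, (1 + ‖w t‖)) (nhdsWithin b (Set.Ico a b)) (nhds 0) := by
      have := h3.mono (Set.Ico_subset_Icc_self)
      simpa [ContinuousWithinAt] using this
    have h5 := h4.eventually (lt_mem_nhds (show (-1/2 : ℝ) < 0 by norm_num))
    have : (nhdsWithin b (Set.Ico a b)).NeBot := by
      rw [← mem_closure_iff_nhdsWithin_neBot, closure_Ico hab.ne]
      exact Set.right_mem_Icc.2 hab.le
    obtain ⟨c, hc1, hc2⟩ := (h5.and self_mem_nhdsWithin).exists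
    refine ⟨c, hc2, ?_⟩
    rw [intervalIntegral.integral_symm]
    linarith
  set D := ∫ t in c..b, ‖f t‖ with hD
  have sub : ∀ x y, a ≤ x → x ≤ y → y ≤ b → Set.uIcc x y ⊆ Set.uIcc a b := by
    intro x y h1 h2 h3
    rw [Set.uIcc_of_le h2, Set.uIcc_of_le hab.le]
    exact Set.Icc_subset_Icc h1 h3
  have main : ∀ x ∈ Set.Ico c b, ‖u x‖ + ‖u' x‖ ≤ 2 * (‖u c‖ + ‖u' c‖ + D) := by
    intro x hx
    have hsub : Set.Icc c x ⊆ Set.Ico a b := fun t ht => ⟨hc.1.trans ht.1, ht.2.trans_lt hx.2⟩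
    obtain ⟨y, hy, hmax⟩ := (isCompact_Icc (a := c) (b := x)).exists_isMaxOn
      ⟨c, Set.left_mem_Icc.2 hx.1⟩ ((cu.mono hsub).norm.add (cu'.mono hsub).norm)
    have hN : ∀ t ∈ Set.Icc c x, ‖u t‖ + ‖u' t‖ ≤ ‖u y‖ + ‖u' y‖ := fun t ht => hmax ht
    set N := ‖u y‖ + ‖u' y‖ with hNdef
    have hN0 : 0 ≤ N := by positivity
    have hyab := hsub hy
    have hcab : c ∈ Set.Ico a b := hc
    have hcy := hy.1
    have s := sub c y hc.1 hy.1 hyab.2.le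
    have e1 : u y - u c = ∫ t in c..y, u' t := by
      rw [h1 y hyab, h1 c hc, ← intervalIntegral.integral_interval_sub_left (i1 y hyab) (i1 c hc)]; ring
    have e2 : u' y - u' c = ∫ t in c..y, (w t * u t - f t) := by
      rw [h2 y hyab, h2 c hc, ← intervalIntegral.integral_interval_sub_left (i2 y hyab) (i2 c hc)]; ring
    have b1 : ‖u y - u c‖ ≤ ∫ t in c..y, N := by
      rw [e1]
      refine intervalIntegral.norm_integral_le_of_norm_le hcy (Filter.Eventually.of_forall ?_) intervalIntegrable_const
      intro t ht
      have := hN t ⟨ht.1.le, ht.2.trans hy.2⟩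
      linarith [norm_nonneg (u t)]
    have iw : IntervalIntegrable (fun t => ‖w t‖ * N) volume c y := ((hw.mono_set s).norm.mul_const N)
    have ifn : IntervalIntegrable (fun t => ‖f t‖) volume c y := (hf.mono_set s).norm
    have b2 : ‖u' y - u' c‖ ≤ ∫ t in c..y, (‖w t‖ * N + ‖f t‖) := by
      rw [e2]
      refine intervalIntegral.norm_integral_le_of_norm_le hcy (Filter.Eventually.of_forall ?_) (iw.add ifn)
      intro t ht
      have := hN t ⟨ht.1.le, ht.2.trans hy.2⟩
      calc ‖w t * u t - f t‖ ≤ ‖w t * u t‖ + ‖f t‖ := norm_sub_le _ _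
        _ = ‖w t‖ * ‖u t‖ + ‖f t‖ := by rw [norm_mul]
        _ ≤ _ := by gcongr; linarith [norm_nonneg (u' t)]
    have ip : IntervalIntegrable (fun t => 1 + ‖w t‖) volume c y := hp.mono_set s
    have tot : (∫ t in c..y, N) + ∫ t in c..y, (‖w t‖ * N + ‖f t‖) =
        N * (∫ t in c..y, (1 + ‖w t‖)) + ∫ t in c..y, ‖f t‖ := by
      rw [intervalIntegral.integral_add iw ifn, ← add_assoc, ← intervalIntegral.integral_add intervalIntegrable_const iw,
        ← intervalIntegral.integral_const_mul]
      congr 1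
      apply intervalIntegral.integral_congr
      intro t _; ring
    have m1 : ∫ t in c..y, (1 + ‖w t‖) ≤ 1 / 2 := by
      refine le_trans ?_ hcs
      refine intervalIntegral.integral_mono_interval le_rfl hcy hyab.2.le ?_ (hp.mono_set (sub c b hc.1 hc.2.le le_rfl))
      exact Filter.Eventually.of_forall fun t => by simp only [Pi.zero_apply]; positivity
    have m2 : ∫ t in c..y, ‖f t‖ ≤ D := by
      refine intervalIntegral.integral_mono_interval le_rfl hcy hyab.2.le ?_ (hf.mono_set (sub c b hc.1 hc.2.le le_rfl)).norm
      exact Filter.Eventually.of_forall fun t => by simp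
    have t1 : ‖u y‖ ≤ ‖u c‖ + ‖u y - u c‖ := by
      have := norm_add_le (u c) (u y - u c); simpa using this
    have t2 : ‖u' y‖ ≤ ‖u' c‖ + ‖u' y - u' c‖ := by
      have := norm_add_le (u' c) (u' y - u' c); simpa using this
    have hx' := hN x ⟨hx.1, le_rfl⟩
    nlinarith
  obtain ⟨C1, hC1⟩ := (isCompact_Icc (a := a) (b := c)).exists_bound_of_continuousOn
    (cu.mono fun t ht => ⟨ht.1, ht.2.trans_lt hc.2⟩)
  obtain ⟨C2, hC2⟩ := (isCompact_Icc (a := a) (b := c)).exists_bound_of_continuousOn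
    (cu'.mono fun t ht => ⟨ht.1, ht.2.trans_lt hc.2⟩)
  refine ⟨max (max C1 C2) (2 * (‖u c‖ + ‖u' c‖ + D)), fun x hx => ?_⟩
  rcases le_total x c with h | h
  · exact ⟨(hC1 x ⟨hx.1, h⟩).trans (by simp), (hC2 x ⟨hx.1, h⟩).trans (by simp)⟩
  · have := main x ⟨h, hx.2⟩
    constructor
    · exact le_max_of_le_right (by linarith [norm_nonneg (u' x)])
    · exact le_max_of_le_right (by linarith [norm_nonneg (u x)])

theorem int_of_bdd {v : ℝ → ℂ} {a b M : ℝ} (hab : a ≤ b) (cv : ContinuousOn v (Set.Ico a b))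
    (hM : ∀ x ∈ Set.Ico a b, ‖v x‖ ≤ M) {w : ℝ → ℂ} (hw : IntervalIntegrable w volume a b) :
    IntervalIntegrable (fun t => w t * v t) volume a b := by
  rw [intervalIntegrable_iff_integrableOn_Ico_of_le hab] at hw ⊢
  refine Integrable.mul_bdd (c := M) hw (cv.aestronglyMeasurable measurableSet_Ico) ?_
  exact (ae_restrict_iff' measurableSet_Ico).2 (Filter.Eventually.of_forall hM)

theorem reg_right {w f u u' : ℝ → ℂ} {a X : ℝ} (haX : a < X) (hw : IntervalIntegrable w volume a X)
    (hf : IntervalIntegrable f volume a X)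
    (h1 : ∀ x ∈ Set.Ico a X, u x = u a + ∫ t in a..x, u' t)
    (h2 : ∀ x ∈ Set.Ico a X, u' x = u' a + ∫ t in a..x, (w t * u t - f t)) :
    IntervalIntegrable u' volume a X ∧ IntervalIntegrable (fun t => w t * u t - f t) volume a X := by
  by_contra hcon
  set P : ℝ → Prop := fun x => IntervalIntegrable u' volume a x ∧
    IntervalIntegrable (fun t => w t * u t - f t) volume a x with hP
  have Pa : P a := ⟨by simp, by simp⟩
  have sub : ∀ x y, a ≤ x → x ≤ y → Set.uIcc a x ⊆ Set.uIcc a y := by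
    intro x y h1 h2
    rw [Set.uIcc_of_le h1, Set.uIcc_of_le (h1.trans h2)]
    exact Set.Icc_subset_Icc le_rfl h2
  have Pmono : ∀ x y, a ≤ x → x ≤ y → P y → P x := fun x y h1 h2 h =>
    ⟨h.1.mono_set (sub x y h1 h2), h.2.mono_set (sub x y h1 h2)⟩
  set S := {x | x ∈ Set.Icc a X ∧ P x} with hS
  have Sne : S.Nonempty := ⟨a, ⟨le_rfl, haX.le⟩, Pa⟩
  have Sbdd : BddAbove S := ⟨X, fun x hx => hx.1.2⟩
  set b := sSup S with hb
  have hab : a ≤ b := le_csSup Sbdd ⟨⟨le_rfl, haX.le⟩, Pa⟩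
  have hbX : b ≤ X := csSup_le Sne fun x hx => hx.1.2
  have Plt : ∀ x ∈ Set.Ico a b, P x := by
    intro x hx
    obtain ⟨y, hy, hxy⟩ := exists_lt_of_lt_csSup Sne hx.2
    exact Pmono x y hx.1 hxy.le hy.2
  have Pgt : ∀ x, b < x → x ≤ X → ¬ P x := by
    intro x hx hxX hPx
    exact absurd (le_csSup Sbdd ⟨⟨hab.trans hx.le, hxX⟩, hPx⟩) (not_le.2 hx)
  have Pb : P b := by
    rcases hab.eq_or_lt with h | h
    · rw [← h]; exact Pa
    · have hwb := hw.mono_set (sub b X hab hbX)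
      have hfb := hf.mono_set (sub b X hab hbX)
      obtain ⟨cu, cu', M, hM⟩ := bdd_step h hwb hfb
        (fun x hx => h1 x ⟨hx.1, hx.2.trans_le hbX⟩) (fun x hx => h2 x ⟨hx.1, hx.2.trans_le hbX⟩)
        (fun x hx => (Plt x hx).1) (fun x hx => (Plt x hx).2)
      constructor
      · have := int_of_bdd hab cu' (fun x hx => (hM x hx).2) (w := fun _ => 1) intervalIntegrable_const
        simpa using this
      · exact (int_of_bdd hab cu (fun x hx => (hM x hx).1) hwb).sub hfb
  have hbX' : b < X := lt_of_le_of_ne hbX fun h => hcon (h ▸ Pb)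
  by_cases hB : ∃ x1 ∈ Set.Ioo b X, IntervalIntegrable u' volume a x1
  · obtain ⟨x1, hx1, hi⟩ := hB
    have hax1 : a ≤ x1 := hab.trans hx1.1.le
    have cu := contOn_of_prim hax1 hi fun x hx => h1 x ⟨hx.1, hx.2.trans_lt hx1.2⟩
    refine Pgt x1 hx1.1 hx1.2.le ⟨hi, ?_⟩
    have s := sub x1 X hax1 hx1.2.le
    exact ((hw.mono_set s).mul_continuousOn (by rwa [Set.uIcc_of_le hax1])).sub (hf.mono_set s)
  · push Not at hB
    have hconst : ∀ x ∈ Set.Ioo b X, u x = u a := by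
      intro x hx
      rw [h1 x ⟨hab.trans hx.1.le, hx.2⟩, intervalIntegral.integral_undef (hB x hx), add_zero]
    have s : Set.uIcc b X ⊆ Set.uIcc a X := by
      rw [Set.uIcc_of_le hbX, Set.uIcc_of_le haX.le]; exact Set.Icc_subset_Icc hab le_rfl
    have gi : IntervalIntegrable (fun t => w t * u t - f t) volume b X := by
      have : IntervalIntegrable (fun t => w t * u a - f t) volume b X :=
        ((hw.mono_set s).mul_const _).sub (hf.mono_set s)
      rw [intervalIntegrable_iff_integrableOn_Ioo_of_le hbX] at this ⊢
      refine this.congr_fun (fun x hx => ?_) measurableSet_Ioo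
      simp only [hconst x hx]
    have gi' := Pb.2.trans gi
    refine hcon ⟨?_, gi'⟩
    have c1 := intervalIntegral.continuousOn_primitive_interval' gi' (a := a) (by simp)
    have : IntervalIntegrable (fun x => u' a + ∫ t in a..x, (w t * u t - f t)) volume a X :=
      (continuousOn_const.add c1).intervalIntegrable
    rw [intervalIntegrable_iff_integrableOn_Ico_of_le haX.le] at this ⊢
    exact this.congr_fun (fun x hx => (h2 x hx).symm) measurableSet_Ico
structure Sol (V : ℝ → ℝ) (z : ℂ) (f U U' : ℝ → ℂ) : Prop where
  cU : Continuous U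
  cU' : Continuous U'
  eU : ∀ x, 0 ≤ x → U x = U 0 + ∫ t in (0 : ℝ)..x, U' t
  eU' : ∀ x, 0 ≤ x → U' x = U' 0 + ∫ t in (0 : ℝ)..x, (((V t : ℂ) - z) * U t - f t)

def LI (f : ℝ → ℂ) : Prop := ∀ x, 0 ≤ x → IntervalIntegrable f volume 0 x

theorem cont_prim {g : ℝ → ℂ} (hg : LI g) : Continuous (fun x => ∫ t in (0 : ℝ)..max x 0, g t) := by
  have h1 : ∀ a b, IntervalIntegrable (Set.indicator (Set.Ioi 0) g) volume a b := by
    intro a b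
    rw [intervalIntegrable_iff, IntegrableOn, integrable_indicator_iff measurableSet_Ioi, IntegrableOn,
      Measure.restrict_restrict measurableSet_Ioi]
    have := hg (max (max a b) 0) (le_max_right _ _)
    rw [intervalIntegrable_iff_integrableOn_Ioc_of_le (le_max_right _ _)] at this
    refine this.mono_set ?_
    rintro t ⟨ht1, ht2⟩
    exact ⟨ht1, le_max_of_le_left ht2.2⟩
  have h2 := intervalIntegral.continuous_primitive h1 0
  have h3 : (fun x => ∫ t in (0 : ℝ)..max x 0, g t) = fun x => ∫ t in (0 : ℝ)..max x 0, Set.indicator (Set.Ioi 0) g t := by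
    funext x
    rw [intervalIntegral.integral_of_le (le_max_right _ _), intervalIntegral.integral_of_le (le_max_right _ _)]
    apply setIntegral_congr_fun measurableSet_Ioc
    intro t ht
    simp [Set.indicator, ht.1]
  rw [h3]
  exact h2.comp (continuous_id.max continuous_const)

theorem LI_V {V : ℝ → ℝ} (hV : LocallyIntegrable V volume) (z : ℂ) (a b : ℝ) :
    IntervalIntegrable (fun t => (V t : ℂ) - z) volume a b := by
  have h1 : IntervalIntegrable V volume a b := intervalIntegrable_iff.mpr
    ((hV.integrableOn_isCompact isCompact_uIcc).mono_set Set.uIoc_subset_uIcc)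
  have h2 : IntervalIntegrable (fun t => (V t : ℂ)) volume a b := ⟨h1.1.ofReal, h1.2.ofReal⟩
  exact h2.sub intervalIntegrable_const

theorem LI_mono {g : ℝ → ℂ} (hg : LI g) {a b : ℝ} (ha : 0 ≤ a) (hb : 0 ≤ b) :
    IntervalIntegrable g volume a b := (hg a ha).symm.trans (hg b hb)

theorem sol_of {V : ℝ → ℝ} (hV : LocallyIntegrable V volume) {z : ℂ} {f u u' : ℝ → ℂ} (hf : LI f)
    (h : IsSolOnInhom V z f u u' (Set.Ioi 0) 1) :
    ∃ U U', Sol V z f U U' ∧ (∀ x, 0 < x → u x = U x) ∧ (∀ x, 0 < x → u' x = U' x) := by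
  obtain ⟨h1, h2⟩ := h
  set g : ℝ → ℂ := fun t => ((V t : ℂ) - z) * u t - f t with hg
  have right : ∀ x, 1 < x → IntervalIntegrable u' volume 1 x ∧ IntervalIntegrable g volume 1 x := by
    intro x hx
    exact reg_right hx (LI_V hV z 1 x) (LI_mono hf zero_le_one (by linarith))
      (fun y hy => h1 y (lt_of_lt_of_le one_pos hy.1)) (fun y hy => h2 y (lt_of_lt_of_le one_pos hy.1))
  have left : IntervalIntegrable u' volume 1 0 ∧ IntervalIntegrable g volume 1 0 := by
    have hw : IntervalIntegrable (fun t => (V (-t) : ℂ) - z) volume (-1) 0 := by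
      have := (IntervalIntegrable.iff_comp_neg (by simp)).1 (LI_V hV z 1 0)
      simpa using this
    have hf' : IntervalIntegrable (fun t => f (-t)) volume (-1) 0 := by
      have := (IntervalIntegrable.iff_comp_neg (by simp)).1 (LI_mono hf zero_le_one le_rfl)
      simpa using this
    have := reg_right (u := fun t => u (-t)) (u' := fun t => - u' (-t)) (by norm_num : (-1 : ℝ) < 0) hw hf' ?_ ?_
    · have a1 := (IntervalIntegrable.iff_comp_neg (by simp)).1 this.1.neg
      have a2 := (IntervalIntegrable.iff_comp_neg (by simp)).1 this.2
      simp only [neg_neg, neg_zero, Pi.neg_apply] at a1 a2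
      exact ⟨a1, a2⟩
    · intro x hx
      have := h1 (-x) (by simpa using hx.2)
      simp only [neg_neg, this, intervalIntegral.integral_neg, intervalIntegral.integral_comp_neg, ← intervalIntegral.integral_symm]
    · intro x hx
      have := h2 (-x) (by simpa using hx.2)
      have e := intervalIntegral.integral_comp_neg (a := -1) (b := x) g
      simp only [hg] at e
      simp only [neg_neg] at e ⊢
      rw [e, this, intervalIntegral.integral_symm]; ring
  have all0 : ∀ x, 0 ≤ x → IntervalIntegrable u' volume 0 x ∧ IntervalIntegrable g volume 0 x := by
    intro x hx
    rcases le_or_gt x 1 with h | h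
    · have s : Set.uIcc 0 x ⊆ Set.uIcc 1 0 := by
        rw [Set.uIcc_of_le hx, Set.uIcc_of_ge zero_le_one]; exact Set.Icc_subset_Icc le_rfl h
      exact ⟨left.1.mono_set s, left.2.mono_set s⟩
    · exact ⟨left.1.symm.trans (right x h).1, left.2.symm.trans (right x h).2⟩
  have li1 : LI u' := fun x hx => (all0 x hx).1
  have li2 : LI g := fun x hx => (all0 x hx).2
  set U : ℝ → ℂ := fun x => (u 1 + ∫ t in (1 : ℝ)..0, u' t) + ∫ t in (0 : ℝ)..max x 0, u' t with hU
  set U' : ℝ → ℂ := fun x => (u' 1 + ∫ t in (1 : ℝ)..0, g t) + ∫ t in (0 : ℝ)..max x 0, g t with hU'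
  have e1 : ∀ x, 0 < x → u x = U x := by
    intro x hx
    simp only [hU]
    rw [h1 x hx, max_eq_left hx.le, add_assoc, intervalIntegral.integral_add_adjacent_intervals left.1 (li1 x hx.le)]
  have e2 : ∀ x, 0 < x → u' x = U' x := by
    intro x hx
    simp only [hU']
    rw [h2 x hx, max_eq_left hx.le, add_assoc, intervalIntegral.integral_add_adjacent_intervals left.2 (li2 x hx.le)]
  refine ⟨U, U', ⟨continuous_const.add (cont_prim li1), continuous_const.add (cont_prim li2), ?_, ?_⟩, e1, e2⟩
  · intro x hx
    have : ∫ t in (0 : ℝ)..x, U' t = ∫ t in (0 : ℝ)..x, u' t := by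
      apply intervalIntegral.integral_congr_ae
      refine Filter.Eventually.of_forall fun t ht => ?_
      rw [Set.uIoc_of_le hx] at ht
      exact (e2 t ht.1).symm
    rw [this]
    simp [hU, max_eq_left hx]
  · intro x hx
    have : ∫ t in (0 : ℝ)..x, (((V t : ℂ) - z) * U t - f t) = ∫ t in (0 : ℝ)..x, g t := by
      apply intervalIntegral.integral_congr_ae
      refine Filter.Eventually.of_forall fun t ht => ?_
      rw [Set.uIoc_of_le hx] at ht
      simp only [hg]
      rw [(e1 t ht.1)]
    rw [this]
    simp [hU', max_eq_left hx]

section SolLemmas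
variable {V : ℝ → ℝ} {z : ℂ} {f h U U' Y Y' : ℝ → ℂ}

theorem Sol.li (hV : LocallyIntegrable V volume) (hf : LI f) (hU : Continuous U) :
    LI (fun t => ((V t : ℂ) - z) * U t - f t) := fun x hx =>
  ((LI_V hV z 0 x).mul_continuousOn hU.continuousOn).sub (hf x hx)

theorem Sol.comb (hV : LocallyIntegrable V volume) (hf : LI f) (hh : LI h)
    (s : Sol V z f U U') (r : Sol V z h Y Y') (c : ℂ) :
    Sol V z (fun t => f t + c * h t) (fun t => U t + c * Y t) (fun t => U' t + c * Y' t) where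
  cU := s.cU.add (continuous_const.mul r.cU)
  cU' := s.cU'.add (continuous_const.mul r.cU')
  eU x hx := by
    rw [s.eU x hx, r.eU x hx, intervalIntegral.integral_add (s.cU'.intervalIntegrable _ _)
      ((r.cU'.intervalIntegrable _ _).const_mul c), intervalIntegral.integral_const_mul]
    ring
  eU' x hx := by
    rw [s.eU' x hx, r.eU' x hx]
    have : ∀ t, ((V t : ℂ) - z) * (U t + c * Y t) - (f t + c * h t) =
      (((V t : ℂ) - z) * U t - f t) + c * (((V t : ℂ) - z) * Y t - h t) := fun t => by ring
    simp only [this]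
    rw [intervalIntegral.integral_add (Sol.li hV hf s.cU x hx)
      ((Sol.li hV hh r.cU x hx).const_mul c), intervalIntegral.integral_const_mul]
    ring

theorem Sol.shift (s : Sol V z f U U') (z' : ℂ) : Sol V z' (fun t => f t + (z - z') * U t) U U' where
  cU := s.cU
  cU' := s.cU'
  eU := s.eU
  eU' x hx := by
    rw [s.eU' x hx]; congr 1
    apply intervalIntegral.integral_congr
    intro t _; ring

theorem Sol.congr (s : Sol V z f U U') (e : ∀ᵐ t ∂(volume.restrict (Set.Ioi (0 : ℝ))), f t = h t) : Sol V z h U U' where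
  cU := s.cU
  cU' := s.cU'
  eU := s.eU
  eU' x hx := by
    rw [s.eU' x hx]; congr 1
    apply intervalIntegral.integral_congr_ae
    rw [ae_restrict_iff' measurableSet_Ioi] at e
    filter_upwards [e] with t ht ht2
    rw [Set.uIoc_of_le hx] at ht2
    rw [ht ht2.1]

theorem Sol.conj (s : Sol V z f U U') : Sol V (star z) (fun t => star (f t)) (fun t => star (U t)) (fun t => star (U' t)) where
  cU := s.cU.star
  cU' := s.cU'.star
  eU x hx := by
    have := congrArg star (s.eU x hx)
    rw [this, star_add]; congr 1
    simp only [Complex.star_def, intervalIntegral.integral_of_le hx]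
    exact integral_conj.symm
  eU' x hx := by
    have := congrArg star (s.eU' x hx)
    rw [this, star_add]; congr 1
    simp only [Complex.star_def, intervalIntegral.integral_of_le hx]
    rw [← integral_conj]
    simp

theorem Sol.wronsk (hV : LocallyIntegrable V volume) (hf : LI f) (hh : LI h)
    (s : Sol V z f U U') (r : Sol V z h Y Y') {x : ℝ} (hx : 0 ≤ x) :
    U x * Y' x - U' x * Y x = (U 0 * Y' 0 - U' 0 * Y 0) + ∫ t in (0 : ℝ)..x, (f t * Y t - U t * h t) := by
  have m : ∀ t ∈ Set.uIcc 0 x, 0 ≤ t := fun t ht => by rw [Set.uIcc_of_le hx] at ht; exact ht.1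
  have p1 := prod_rule (s.cU'.intervalIntegrable 0 x) (Sol.li hV hh r.cU x hx (z := z))
    (fun t ht => s.eU t (m t ht)) (fun t ht => r.eU' t (m t ht))
  have p2 := prod_rule (Sol.li hV hf s.cU x hx (z := z)) (r.cU'.intervalIntegrable 0 x)
    (fun t ht => s.eU' t (m t ht)) (fun t ht => r.eU t (m t ht))
  rw [p1, p2, add_sub_add_comm, ← intervalIntegral.integral_sub]
  · congr 1
    apply intervalIntegral.integral_congr
    intro t _; ring
  · exact ((s.cU'.mul r.cU').intervalIntegrable _ _).add ((Sol.li hV hh r.cU x hx).continuousOn_mul s.cU.continuousOn)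
  · exact ((Sol.li hV hf s.cU x hx).mul_continuousOn r.cU.continuousOn).add ((s.cU'.mul r.cU').intervalIntegrable _ _)

theorem Sol.isSolOn (hV : LocallyIntegrable V volume) (s : Sol V z (fun _ => 0) U U') : IsSolOn V z U U' (Set.Ioi 0) 1 := by
  have l0 : LI (fun _ => 0) := fun x _ => intervalIntegrable_const
  have l := Sol.li hV l0 s.cU (z := z)
  constructor
  · intro x hx
    have hx : 0 < x := hx
    rw [s.eU x hx.le, s.eU 1 zero_le_one, add_assoc, intervalIntegral.integral_add_adjacent_intervals] <;>
    exact s.cU'.intervalIntegrable _ _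
  · intro x hx
    have hx : 0 < x := hx
    rw [s.eU' x hx.le, s.eU' 1 zero_le_one, add_assoc, intervalIntegral.integral_add_adjacent_intervals]
    · exact l 1 zero_le_one
    · exact LI_mono l zero_le_one hx.le

theorem Sol.hasDerivAt (s : Sol V z f U U') {x : ℝ} (hx : 0 < x) : HasDerivAt U (U' x) x := by
  have h1 : HasDerivAt (fun y => U 0 + ∫ t in (0 : ℝ)..y, U' t) (U' x) x :=
    (s.cU'.integral_hasStrictDerivAt 0 x).hasDerivAt.const_add _
  refine h1.congr_of_eventuallyEq ?_
  filter_upwards [lt_mem_nhds hx] with y hy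
  exact s.eU y hy.le

end SolLemmas
theorem abs_unit {E : Type*} [NormedAddCommGroup E] [NormedSpace ℂ E] [CompleteSpace E]
    {A : E →L[ℂ] E} (n : ℕ) (h : ‖A ^ n‖ < 1) : IsUnit (1 - A) := by
  have hu : IsUnit (1 - A ^ n) := isUnit_one_sub_of_norm_lt_one h
  rw [← mul_neg_geom_sum] at hu
  refine ((Commute.isUnit_mul_iff ?_).1 hu).1
  have c1 : Commute A (∑ i ∈ Finset.range n, A ^ i) :=
    Commute.sum_right _ _ _ fun i _ => Commute.pow_right (Commute.refl _) i
  exact (Commute.one_left _).sub_left c1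

theorem abs_diff {E : Type*} [NormedAddCommGroup E] [NormedSpace ℂ E] [CompleteSpace E]
    (A B : E →L[ℂ] E) (g : E) (z : ℂ) (hu : IsUnit (1 - (A - z • B))) :
    DifferentiableAt ℂ (fun z : ℂ => (Ring.inverse (1 - (A - z • B))) g) z := by
  have d1 : DifferentiableAt ℂ (fun z : ℂ => (1 - (A - z • B))) z := by fun_prop
  have d2 := (differentiableAt_inverse (𝕜 := ℂ) hu).comp z d1
  exact d2.clm_apply (differentiableAt_const _)

section Volterra
variable {b : ℝ}

noncomputable def ext (hb : 0 ≤ b) (q : C(Set.Icc 0 b, ℂ)) : ℝ → ℂ := fun t => q (Set.projIcc 0 b hb t)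

theorem ext_cont (hb : 0 ≤ b) (q : C(Set.Icc 0 b, ℂ)) : Continuous (ext hb q) :=
  q.continuous.comp continuous_projIcc

theorem ext_le (hb : 0 ≤ b) (q : C(Set.Icc 0 b, ℂ)) (t : ℝ) : ‖ext hb q t‖ ≤ ‖q‖ := q.norm_coe_le_norm _

theorem ext_val (hb : 0 ≤ b) (q : C(Set.Icc 0 b, ℂ)) (t : Set.Icc 0 b) : ext hb q t = q t := by
  simp [ext]

theorem dbl_cont {g : ℝ → ℂ} (hg : ∀ x y, IntervalIntegrable g volume x y) :
    Continuous (fun x => ∫ t in b..x, ∫ s in b..t, g s) := by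
  have h1 := intervalIntegral.continuous_primitive hg b
  exact intervalIntegral.continuous_primitive (fun x y => h1.intervalIntegrable x y) b

theorem dbl_le {g : ℝ → ℂ} (hg : ∀ x y, IntervalIntegrable g volume x y) {x : ℝ} (hx : x ∈ Set.Icc 0 b) :
    ‖∫ t in b..x, ∫ s in b..t, g s‖ ≤ b * ∫ t in x..b, ‖g t‖ := by
  have h0 : 0 ≤ ∫ t in x..b, ‖g t‖ := intervalIntegral.integral_nonneg hx.2 fun t _ => norm_nonneg _
  have := intervalIntegral.norm_integral_le_of_norm_le_const (a := b) (b := x)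
    (f := fun t => ∫ s in b..t, g s) (C := ∫ t in x..b, ‖g t‖) ?_
  · refine this.trans ?_
    rw [mul_comm]
    gcongr
    rw [abs_le]; constructor <;> linarith [hx.1, hx.2]
  · intro t ht
    rw [Set.uIoc_of_ge hx.2] at ht
    rw [intervalIntegral.integral_symm, norm_neg]
    refine (intervalIntegral.norm_integral_le_integral_norm ht.2).trans ?_
    exact intervalIntegral.integral_mono_interval ht.1.le ht.2 le_rfl
      (Filter.Eventually.of_forall fun t => norm_nonneg _) (hg _ _).norm

noncomputable def volt (hb : 0 ≤ b) (v : ℝ → ℂ) (hv : ∀ x y, IntervalIntegrable v volume x y) :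
    C(Set.Icc 0 b, ℂ) →L[ℂ] C(Set.Icc 0 b, ℂ) :=
  LinearMap.mkContinuous
    { toFun := fun q => ⟨fun x => ∫ t in b..(x : ℝ), ∫ s in b..t, v s * ext hb q s,
        (dbl_cont fun x y => (hv x y).mul_continuousOn (ext_cont hb q).continuousOn).comp continuous_subtype_val⟩
      map_add' := by
        intro p q
        have ip : ∀ x y, IntervalIntegrable (fun s => v s * ext hb p s) volume x y := fun x y =>
          (hv x y).mul_continuousOn (ext_cont hb p).continuousOn
        have iq : ∀ x y, IntervalIntegrable (fun s => v s * ext hb q s) volume x y := fun x y =>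
          (hv x y).mul_continuousOn (ext_cont hb q).continuousOn
        ext x
        simp only [ContinuousMap.coe_mk, ContinuousMap.add_apply]
        rw [← intervalIntegral.integral_add ((intervalIntegral.continuous_primitive ip b).intervalIntegrable _ _)
          ((intervalIntegral.continuous_primitive iq b).intervalIntegrable _ _)]
        congr 1; funext t
        rw [← intervalIntegral.integral_add (ip _ _) (iq _ _)]
        congr 1; funext s
        simp [ext, mul_add]
      map_smul' := by
        intro c q
        ext x
        simp only [ContinuousMap.coe_mk, ContinuousMap.smul_apply, RingHom.id_apply, smul_eq_mul]
        rw [← intervalIntegral.integral_const_mul]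
        congr 1; funext t
        rw [← intervalIntegral.integral_const_mul]
        congr 1; funext s
        simp [ext]; ring }
    (b * ∫ t in (0 : ℝ)..b, ‖v t‖) (by
      intro q
      have h0 : 0 ≤ ∫ t in (0 : ℝ)..b, ‖v t‖ := intervalIntegral.integral_nonneg hb fun t _ => norm_nonneg _
      refine (ContinuousMap.norm_le _ (by positivity)).2 fun x => ?_
      have iq : ∀ x y, IntervalIntegrable (fun s => v s * ext hb q s) volume x y := fun x y =>
          (hv x y).mul_continuousOn (ext_cont hb q).continuousOn
      refine (dbl_le iq x.2).trans ?_
      rw [mul_assoc]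
      refine mul_le_mul_of_nonneg_left ?_ hb
      rw [← intervalIntegral.integral_mul_const]
      refine (intervalIntegral.integral_mono_interval x.2.1 x.2.2 le_rfl
        (Filter.Eventually.of_forall fun t => norm_nonneg _) (iq _ _).norm).trans ?_
      refine intervalIntegral.integral_mono_on hb (iq _ _).norm ((hv _ _).norm.mul_const _) fun t _ => ?_
      rw [norm_mul]
      exact mul_le_mul_of_nonneg_left (ext_le hb q t) (norm_nonneg _))

theorem volt_apply (hb : 0 ≤ b) (v : ℝ → ℂ) (hv : ∀ x y, IntervalIntegrable v volume x y)
    (q : C(Set.Icc 0 b, ℂ)) (x : Set.Icc 0 b) :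
    volt hb v hv q x = ∫ t in b..(x : ℝ), ∫ s in b..t, v s * ext hb q s := rfl

theorem pow_int {w : ℝ → ℝ} {x : ℝ} (hw : IntervalIntegrable w volume x b) (n : ℕ) :
    ∫ t in x..b, w t * (∫ s in t..b, w s) ^ n = (∫ s in x..b, w s) ^ (n + 1) / (n + 1) := by
  have ac : AbsolutelyContinuousOnInterval (fun t => ∫ s in b..t, w s) x b :=
    hw.absolutelyContinuousOnInterval_intervalIntegral (by simp)
  have acp : ∀ m : ℕ, AbsolutelyContinuousOnInterval (fun t => (∫ s in b..t, w s) ^ (m + 1)) x b := by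
    intro m
    induction m with
    | zero => simpa using ac
    | succ k ih => simpa only [pow_succ] using ih.fun_mul ac
  have h := (acp n).integral_deriv_eq_sub
  have e : ∫ t in x..b, deriv (fun t => (∫ s in b..t, w s) ^ (n + 1)) t =
      ∫ t in x..b, ((n : ℝ) + 1) * (-1) ^ n * (w t * (∫ s in t..b, w s) ^ n) := by
    apply intervalIntegral.integral_congr_ae
    filter_upwards [hw.ae_hasDerivAt_integral] with t ht ht2
    have h3 := (ht (Set.uIoc_subset_uIcc ht2) b (by simp)).pow (n + 1)
    have h4 : deriv (fun t => (∫ s in b..t, w s) ^ (n + 1)) t = _ := h3.deriv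
    rw [h4, intervalIntegral.integral_symm t b, neg_pow]
    push_cast
    ring
  rw [e, intervalIntegral.integral_const_mul, intervalIntegral.integral_symm x b] at h
  simp only [intervalIntegral.integral_same] at h
  rw [neg_pow] at h
  have h6 : ((-1 : ℝ)) ^ n ≠ 0 := by positivity
  have h7 : (n : ℝ) + 1 ≠ 0 := by positivity
  rw [eq_div_iff h7]
  apply mul_left_cancel₀ h6
  rw [zero_pow (by omega), pow_succ] at h
  linear_combination h

theorem volt_pow_le (hb : 0 ≤ b) (v : ℝ → ℂ) (hv : ∀ x y, IntervalIntegrable v volume x y) (n : ℕ)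
    (q : C(Set.Icc 0 b, ℂ)) (x : Set.Icc 0 b) :
    ‖((volt hb v hv) ^ n) q x‖ ≤ ‖q‖ * (b ^ n * (∫ t in (x : ℝ)..b, ‖v t‖) ^ n / n.factorial) := by
  induction n generalizing x with
  | zero => simpa using q.norm_coe_le_norm x
  | succ n ih =>
    rw [pow_succ', mul_apply_eq_comp, volt_apply]
    set p := ((volt hb v hv) ^ n) q with hp
    have ip : ∀ x y, IntervalIntegrable (fun s => v s * ext hb p s) volume x y := fun x y =>
          (hv x y).mul_continuousOn (ext_cont hb p).continuousOn
    refine (dbl_le ip x.2).trans ?_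
    have cW : ContinuousOn (fun t => ∫ s in t..b, ‖v s‖) (Set.uIcc (x : ℝ) b) := by
      have := (intervalIntegral.continuous_primitive (fun x y => (hv x y).norm) b).neg
      have e : (fun t => ∫ s in t..b, ‖v s‖) = -(fun t => ∫ s in b..t, ‖v s‖) := by
        funext t
        rw [intervalIntegral.integral_symm]; rfl
      rw [e]
      exact this.continuousOn
    calc b * ∫ t in (x : ℝ)..b, ‖v t * ext hb p t‖
        ≤ b * ∫ t in (x : ℝ)..b, (‖q‖ * b ^ n / n.factorial) * (‖v t‖ * (∫ s in t..b, ‖v s‖) ^ n) := by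
          refine mul_le_mul_of_nonneg_left ?_ hb
          refine intervalIntegral.integral_mono_on x.2.2 (ip _ _).norm
            (((hv _ _).norm.mul_continuousOn (cW.pow n)).const_mul _) fun t ht => ?_
          have ht' : t ∈ Set.Icc 0 b := ⟨x.2.1.trans ht.1, ht.2⟩
          have := ih ⟨t, ht'⟩
          rw [norm_mul]
          have e : ext hb p t = p ⟨t, ht'⟩ := ext_val hb p ⟨t, ht'⟩
          rw [e]
          calc ‖v t‖ * ‖p ⟨t, ht'⟩‖ ≤ ‖v t‖ * _ := mul_le_mul_of_nonneg_left this (norm_nonneg _)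
            _ = _ := by ring
      _ = _ := by
          rw [intervalIntegral.integral_const_mul, pow_int (hv _ _).norm, Nat.factorial_succ]
          push_cast
          have : (n : ℝ) + 1 ≠ 0 := by positivity
          have : (n.factorial : ℝ) ≠ 0 := by positivity
          field_simp
          ring

theorem volt_unit (hb : 0 ≤ b) (v : ℝ → ℂ) (hv : ∀ x y, IntervalIntegrable v volume x y) :
    IsUnit (1 - volt hb v hv) := by
  set W := ∫ t in (0 : ℝ)..b, ‖v t‖ with hW
  have h0 : 0 ≤ W := intervalIntegral.integral_nonneg hb fun t _ => norm_nonneg _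
  have lim := FloorSemiring.tendsto_pow_div_factorial_atTop (b * W)
  obtain ⟨n, hn⟩ := (lim.eventually (gt_mem_nhds (show (0 : ℝ) < 1 by norm_num))).exists
  have hnorm : ‖(volt hb v hv) ^ n‖ < 1 := by
    refine lt_of_le_of_lt ?_ hn
    refine ContinuousLinearMap.opNorm_le_bound _ (by positivity) fun q => ?_
    refine (ContinuousMap.norm_le _ (by positivity)).2 fun x => ?_
    refine (volt_pow_le hb v hv n q x).trans ?_
    rw [mul_comm, mul_pow]
    have h1 : ∫ t in (x : ℝ)..b, ‖v t‖ ≤ W := intervalIntegral.integral_mono_interval x.2.1 x.2.2 le_rfl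
        (Filter.Eventually.of_forall fun t => norm_nonneg _) (hv _ _).norm
    have h2 : 0 ≤ ∫ t in (x : ℝ)..b, ‖v t‖ := intervalIntegral.integral_nonneg x.2.2 fun t _ => norm_nonneg _
    gcongr
  exact abs_unit n hnorm

theorem volt_lin (hb : 0 ≤ b) {V : ℝ → ℝ} (hV : LocallyIntegrable V volume) (z : ℂ) :
    volt hb (fun t => (V t : ℂ) - z) (LI_V hV z) =
      volt hb (fun t => (V t : ℂ) - 0) (LI_V hV 0) - z • volt hb (fun _ => 1) (fun _ _ => intervalIntegrable_const) := by
  ext q x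
  have i1 : ∀ x y, IntervalIntegrable (fun s => ((V s : ℂ) - 0) * ext hb q s) volume x y := fun x y =>
    (LI_V hV 0 x y).mul_continuousOn (ext_cont hb q).continuousOn
  have i2 : ∀ x y, IntervalIntegrable (fun s => 1 * ext hb q s) volume x y := fun x y =>
    (continuous_const.mul (ext_cont hb q)).intervalIntegrable x y
  simp only [sub_apply, smul_apply, ContinuousMap.sub_apply, ContinuousMap.smul_apply,
    volt_apply, smul_eq_mul]
  rw [← intervalIntegral.integral_const_mul, ← intervalIntegral.integral_sub
    ((intervalIntegral.continuous_primitive i1 b).intervalIntegrable _ _)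
    (((intervalIntegral.continuous_primitive i2 b).intervalIntegrable _ _).const_mul z)]
  congr 1; funext t
  rw [← intervalIntegral.integral_const_mul, ← intervalIntegral.integral_sub (i1 _ _) ((i2 _ _).const_mul z)]
  congr 1; funext s
  ring

noncomputable def src (h : ℝ → ℂ) (hh : ∀ x y, IntervalIntegrable h volume x y) : C(Set.Icc 0 b, ℂ) :=
  ⟨fun x => -∫ t in b..(x : ℝ), ∫ s in b..t, h s, ((dbl_cont hh).comp continuous_subtype_val).neg⟩

noncomputable def qz (hb : 0 ≤ b) {V : ℝ → ℝ} (hV : LocallyIntegrable V volume) (h : ℝ → ℂ)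
    (hh : ∀ x y, IntervalIntegrable h volume x y) (z : ℂ) : C(Set.Icc 0 b, ℂ) :=
  Ring.inverse (1 - (volt hb (fun t => (V t : ℂ) - 0) (LI_V hV 0) -
    z • volt hb (fun _ => 1) (fun _ _ => intervalIntegrable_const))) (src h hh)

theorem qz_diff (hb : 0 ≤ b) {V : ℝ → ℝ} (hV : LocallyIntegrable V volume) (h : ℝ → ℂ)
    (hh : ∀ x y, IntervalIntegrable h volume x y) : Differentiable ℂ (qz hb hV h hh) := by
  intro z
  have hu := volt_unit hb _ (LI_V hV z)
  rw [volt_lin hb hV] at hu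
  exact abs_diff _ _ _ _ hu

theorem qz_eq (hb : 0 ≤ b) {V : ℝ → ℝ} (hV : LocallyIntegrable V volume) (h : ℝ → ℂ)
    (hh : ∀ x y, IntervalIntegrable h volume x y) (z : ℂ) :
    qz hb hV h hh z = volt hb (fun t => (V t : ℂ) - z) (LI_V hV z) (qz hb hV h hh z) + src h hh := by
  have hu := volt_unit hb _ (LI_V hV z)
  have e := Ring.mul_inverse_cancel _ hu
  have e2 := congrArg (fun T => T (src h hh)) e
  simp only [mul_apply_eq_comp, one_apply_eq_self, sub_apply] at e2
  rw [volt_lin hb hV] at e2 ⊢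
  rw [← e2]
  simp only [qz]
  abel

theorem qz_sol (hb : 0 ≤ b) {V : ℝ → ℝ} (hV : LocallyIntegrable V volume) (h : ℝ → ℂ)
    (hh : ∀ x y, IntervalIntegrable h volume x y) (h0 : ∀ x, b < x → h x = 0) (z : ℂ) :
    ∃ Q', Sol V z h (ext hb (qz hb hV h hh z)) Q' ∧
      ∀ x, b ≤ x → ext hb (qz hb hV h hh z) x = 0 ∧ Q' x = 0 := by
  set q := qz hb hV h hh z with hq
  set Q := ext hb q with hQ
  have cQ : Continuous Q := ext_cont hb q
  have iV : ∀ x y, IntervalIntegrable (fun s => ((V s : ℂ) - z) * Q s) volume x y := fun x y =>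
    (LI_V hV z x y).mul_continuousOn cQ.continuousOn
  have ig : ∀ x y, IntervalIntegrable (fun s => ((V s : ℂ) - z) * Q s - h s) volume x y := fun x y =>
    (iV x y).sub (hh x y)
  set Q' : ℝ → ℂ := fun x => ∫ t in b..x, (((V t : ℂ) - z) * Q t - h t) with hQ'
  have cQ' : Continuous Q' := intervalIntegral.continuous_primitive ig b
  have main : ∀ x ∈ Set.Icc 0 b, Q x = ∫ t in b..x, Q' t := by
    intro x hx
    have e1 : Q x = q ⟨x, hx⟩ := ext_val hb q ⟨x, hx⟩
    rw [e1, hq, qz_eq hb hV h hh z, ContinuousMap.add_apply, volt_apply, ← hq]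
    simp only [src, ContinuousMap.coe_mk, ← sub_eq_add_neg]
    rw [← intervalIntegral.integral_sub ((intervalIntegral.continuous_primitive iV b).intervalIntegrable _ _)
      ((intervalIntegral.continuous_primitive hh b).intervalIntegrable _ _)]
    congr 1; funext t
    rw [← intervalIntegral.integral_sub (iV _ _) (hh _ _)]
  have z1 : ∀ x, b ≤ x → Q x = 0 := by
    intro x hx
    have : Q x = Q b := by
      simp only [hQ, ext]
      rw [Set.projIcc_of_right_le hb hx, Set.projIcc_right]
    rw [this, main b ⟨hb, le_rfl⟩, intervalIntegral.integral_same]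
  have z2 : ∀ x, b ≤ x → Q' x = 0 := by
    intro x hx
    simp only [hQ']
    rw [intervalIntegral.integral_congr_ae (g := fun _ => 0)]
    · simp
    · refine Filter.Eventually.of_forall fun t ht => ?_
      rw [Set.uIoc_of_le hx] at ht
      simp [z1 t ht.1.le, h0 t ht.1]
  have main2 : ∀ x, 0 ≤ x → Q x = ∫ t in b..x, Q' t := by
    intro x hx
    rcases le_total x b with hxb | hxb
    · exact main x ⟨hx, hxb⟩
    · rw [z1 x hxb, intervalIntegral.integral_congr (g := fun _ => 0)]
      · simp
      · intro t ht
        rw [Set.uIcc_of_le hxb] at ht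
        exact z2 t ht.1
  refine ⟨Q', ⟨cQ, cQ', ?_, ?_⟩, fun x hx => ⟨z1 x hx, z2 x hx⟩⟩
  · intro x hx
    rw [main2 x hx, main2 0 le_rfl, intervalIntegral.integral_add_adjacent_intervals] <;>
    exact cQ'.intervalIntegrable _ _
  · intro x hx
    simp only [hQ']
    rw [intervalIntegral.integral_add_adjacent_intervals (ig _ _) (ig _ _)]

end Volterra
noncomputable abbrev mu : Measure ℝ := (volume : Measure ℝ).restrict (Set.Ioi 0)

abbrev HH : Type := Lp ℂ 2 mu

theorem memLp_li {f : ℝ → ℂ} (hf : MemLp f 2 mu) : LI f := by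
  intro x hx
  rw [intervalIntegrable_iff_integrableOn_Ioc_of_le hx]
  have h1 := hf.restrict (Set.Ioc 0 x)
  have e : mu.restrict (Set.Ioc 0 x) = volume.restrict (Set.Ioc 0 x) := by
    rw [mu, Measure.restrict_restrict measurableSet_Ioc]
    congr 1
    exact Set.inter_eq_left.2 fun t ht => ht.1
  rw [e] at h1
  exact h1.integrable one_le_two

theorem lp_li (f : HH) : LI f := memLp_li (Lp.memLp f)

theorem li_zero : LI (fun _ => 0) := fun _ _ => intervalIntegrable_const

theorem eq_ici {F : ℝ → ℂ} (hF : Continuous F) (h : ∀ x, 0 < x → F x = 0) : ∀ x, 0 ≤ x → F x = 0 := by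
  intro x hx
  have hc : IsClosed {x | F x = 0} := isClosed_eq hF continuous_const
  have : closure (Set.Ioi (0 : ℝ)) ⊆ {x | F x = 0} := hc.closure_subset_iff.2 fun x hx => h x hx
  rw [closure_Ioi] at this
  exact this hx

theorem ae_ici {F : ℝ → ℂ} (hF : Continuous F) (h : F =ᵐ[mu] 0) : ∀ x, 0 ≤ x → F x = 0 := by
  apply eq_ici hF
  intro x hx
  have := Measure.eqOn_open_of_ae_eq (μ := volume) h isOpen_Ioi hF.continuousOn continuousOn_const
  exact this hx

theorem res_sol {V : ℝ → ℝ} (hV : LocallyIntegrable V volume) {Rz : ℂ → (HH →L[ℂ] HH)}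
    (hRz : IsHalfLineResolventFamily V Rz) {z : ℂ} (hz : z.im ≠ 0) (f : HH) :
    ∃ U U', Sol V z f U U' ∧ U 0 = 0 ∧ Rz z f =ᵐ[mu] U := by
  obtain ⟨u, u', h1, h2, h3, -⟩ := hRz z hz f
  obtain ⟨U, U', s, e1, -⟩ := sol_of hV (lp_li f) h2
  refine ⟨U, U', s, ?_, ?_⟩
  · have t1 : Filter.Tendsto U (nhdsWithin 0 (Set.Ioi 0)) (nhds (U 0)) :=
      (s.cU.tendsto 0).mono_left nhdsWithin_le_nhds
    have t2 : Filter.Tendsto U (nhdsWithin 0 (Set.Ioi 0)) (nhds 0) := by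
      refine h3.congr' ?_
      filter_upwards [self_mem_nhdsWithin] with x hx
      exact e1 x hx
    exact tendsto_nhds_unique t1 t2
  · refine h1.trans ?_
    filter_upwards [ae_restrict_mem measurableSet_Ioi] with x hx
    exact e1 x hx

theorem memLp_int {U : ℝ → ℂ} (h : MemLp U 2 mu) : IntegrableOn (fun x => ‖U x‖ ^ 2) (Set.Ioi 1) volume := by
  have := (memLp_two_iff_integrable_sq_norm h.1).1 h
  exact IntegrableOn.mono_set this (Set.Ioi_subset_Ioi zero_le_one)

theorem lp_pair {V : ℝ → ℝ} (hV : LocallyIntegrable V volume) (hlp : LimitPointAtTop V) {z : ℂ}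
    (hz : z.im ≠ 0) {Y Y' Z Z' : ℝ → ℂ}
    (s : Sol V z (fun _ => 0) Y Y') (r : Sol V z (fun _ => 0) Z Z') (hY : MemLp Y 2 mu)
    (hZ : MemLp Z 2 mu) :
    ∃ c d : ℂ, (c, d) ≠ 0 ∧ ∀ x, 0 ≤ x → c * Y x + d * Z x = 0 ∧ c * Y' x + d * Z' x = 0 := by
  obtain ⟨c, d, hcd, h⟩ := hlp z hz Y Y' Z Z' (s.isSolOn hV) (r.isSolOn hV) (memLp_int hY) (memLp_int hZ)
  refine ⟨c, d, hcd, fun x hx => ⟨?_, ?_⟩⟩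
  · exact eq_ici (F := fun x => c * Y x + d * Z x)
      ((continuous_const.mul s.cU).add (continuous_const.mul r.cU)) (fun x hx => h x hx) x hx
  · refine eq_ici (F := fun x => c * Y' x + d * Z' x)
      ((continuous_const.mul s.cU').add (continuous_const.mul r.cU')) (fun x hx => ?_) x hx
    have h1 : HasDerivAt (fun x => c * Y x + d * Z x) (c * Y' x + d * Z' x) x :=
      ((s.hasDerivAt hx).const_mul c).add ((r.hasDerivAt hx).const_mul d)
    have h2 : HasDerivAt (fun x => c * Y x + d * Z x) 0 x := by
      refine (hasDerivAt_const x (0 : ℂ)).congr_of_eventuallyEq ?_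
      filter_upwards [lt_mem_nhds hx] with y hy
      exact h y hy
    exact h1.unique h2

theorem lp_wr {V : ℝ → ℝ} (hV : LocallyIntegrable V volume) (hlp : LimitPointAtTop V) {z : ℂ}
    (hz : z.im ≠ 0) {Y Y' Z Z' : ℝ → ℂ}
    (s : Sol V z (fun _ => 0) Y Y') (r : Sol V z (fun _ => 0) Z Z') (hY : MemLp Y 2 mu)
    (hZ : MemLp Z 2 mu) (x : ℝ) (hx : 0 ≤ x) : Y x * Z' x - Y' x * Z x = 0 := by
  obtain ⟨c, d, hcd, h⟩ := lp_pair hV hlp hz s r hY hZ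
  obtain ⟨h1, h2⟩ := h x hx
  by_cases hc : c = 0
  · have hd : d ≠ 0 := by
      rintro rfl; exact hcd (by rw [hc]; rfl)
    apply mul_left_cancel₀ hd
    linear_combination Y x * h2 - Y' x * h1
  · apply mul_left_cancel₀ hc
    linear_combination Z' x * h1 - Z x * h2

theorem ext_memLp {b : ℝ} (hb : 0 ≤ b) (q : C(Set.Icc 0 b, ℂ)) (h : ∀ x, b ≤ x → ext hb q x = 0) :
    MemLp (ext hb q) 2 mu := by
  have h1 : MemLp (Set.indicator (Set.Icc 0 b) (fun _ => ‖q‖)) 2 mu := by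
    refine memLp_indicator_const 2 measurableSet_Icc _ (Or.inr ?_)
    refine ne_top_of_le_ne_top ?_ (Measure.restrict_apply_le _ _)
    simp
  refine h1.mono (ext_cont hb q).aestronglyMeasurable ?_
  filter_upwards [ae_restrict_mem measurableSet_Ioi] with x hx
  by_cases hxb : x ≤ b
  · have : x ∈ Set.Icc 0 b := ⟨le_of_lt hx, hxb⟩
    simpa [this] using ext_le hb q x
  · rw [h x (le_of_not_ge hxb)]; simp

/-- data for a compactly supported right-hand side -/
structure Cut (b : ℝ) (h : HH) (k : ℝ → ℂ) : Prop where
  ii : ∀ x y, IntervalIntegrable k volume x y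
  zero : ∀ x, b < x → k x = 0
  ae : h =ᵐ[mu] k

theorem cut_ii {b : ℝ} (hb : 0 ≤ b) {k : ℝ → ℂ} (hk : LI k) (x y : ℝ) :
    IntervalIntegrable (Set.indicator (Set.Ioc 0 b) k) volume x y := by
  have := hk b hb
  rw [intervalIntegrable_iff_integrableOn_Ioc_of_le hb] at this
  exact ((integrable_indicator_iff measurableSet_Ioc).2 this).intervalIntegrable

theorem cut_of {b : ℝ} (hb : 0 ≤ b) (h : HH) (h0 : ∀ᵐ x ∂mu, b < x → h x = 0) :
    Cut b h (Set.indicator (Set.Ioc 0 b) h) where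
  ii := cut_ii hb (lp_li h)
  zero x hx := Set.indicator_of_notMem (fun H => absurd H.2 (not_le.2 hx)) _
  ae := by
    filter_upwards [h0, ae_restrict_mem measurableSet_Ioi] with x hx hx0
    by_cases hxb : x ≤ b
    · rw [Set.indicator_of_mem]; exact ⟨hx0, hxb⟩
    · rw [Set.indicator_of_notMem (fun H => hxb H.2), hx (not_le.1 hxb)]

theorem decomp {V : ℝ → ℝ} (hV : LocallyIntegrable V volume) {Rz : ℂ → (HH →L[ℂ] HH)}
    (hRz : IsHalfLineResolventFamily V Rz) {z : ℂ} (hz : z.im ≠ 0) {b : ℝ} (hb : 0 ≤ b) {h : HH}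
    {k : ℝ → ℂ} (hk : Cut b h k) :
    ∃ U U' Q', Sol V z k U U' ∧ U 0 = 0 ∧ Rz z h =ᵐ[mu] U ∧
      Sol V z k (ext hb (qz hb hV k hk.ii z)) Q' ∧
      (∀ x, b ≤ x → ext hb (qz hb hV k hk.ii z) x = 0 ∧ Q' x = 0) ∧
      Sol V z (fun _ => 0) (fun t => U t - ext hb (qz hb hV k hk.ii z) t) (fun t => U' t - Q' t) ∧
      MemLp (fun t => U t - ext hb (qz hb hV k hk.ii z) t) 2 mu := by
  obtain ⟨U, U', s, u0, e⟩ := res_sol hV hRz hz h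
  obtain ⟨Q', q, q0⟩ := qz_sol hb hV k hk.ii hk.zero z
  have s' := s.congr hk.ae
  have lk : LI k := fun x _ => hk.ii 0 x
  refine ⟨U, U', Q', s', u0, e, q, q0, ?_, ?_⟩
  · have := Sol.comb hV lk lk s' q (-1)
    simpa [← sub_eq_add_neg] using this
  · exact ((Lp.memLp (Rz z h)).ae_eq e).sub (ext_memLp hb _ fun x hx => (q0 x hx).1)

theorem noeig {V : ℝ → ℝ} (hV : LocallyIntegrable V volume) (hlp : LimitPointAtTop V)
    {Rz : ℂ → (HH →L[ℂ] HH)}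
    (hRz : IsHalfLineResolventFamily V Rz) {z : ℂ} (hz : z.im ≠ 0) {W W' : ℝ → ℂ}
    (s : Sol V z (fun _ => 0) W W') (w0 : W 0 = 0) (hW : MemLp W 2 mu) : ∀ x, 0 ≤ x → W x = 0 := by
  intro x hx
  set b := x + 1 with hbd
  have hb : 0 ≤ b := by positivity
  have m1 : MemLp (Set.indicator (Set.Ioc 0 b) (star W)) 2 mu := hW.star.indicator measurableSet_Ioc
  have ck : Cut b (m1.toLp) (Set.indicator (Set.Ioc 0 b) (star W)) :=
    { ii := cut_ii hb (memLp_li hW.star)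
      zero := fun x hx => Set.indicator_of_notMem (fun H => absurd H.2 (not_le.2 hx)) _
      ae := m1.coeFn_toLp }
  obtain ⟨U, U', Q', sU, u0, e, q, q0, y, my⟩ := decomp hV hRz hz hb ck
  have w := lp_wr hV hlp hz y s my hW b hb
  simp only [q0 b le_rfl, sub_zero] at w
  have w2 := Sol.wronsk hV (fun x _ => ck.ii 0 x) li_zero sU s hb
  rw [w, u0, w0] at w2
  have w3 : ∫ t in (0 : ℝ)..b, ((‖W t‖ ^ 2 : ℝ) : ℂ) = 0 := by
    rw [show (0 : ℂ) = _ from w2]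
    simp only [zero_mul, mul_zero, sub_zero, zero_add]
    apply intervalIntegral.integral_congr_ae
    refine Filter.Eventually.of_forall fun t ht => ?_
    rw [Set.uIoc_of_le hb] at ht
    rw [Set.indicator_of_mem ht]
    simp [Complex.conj_mul']
  rw [intervalIntegral.integral_ofReal] at w3
  have w4 : ∫ t in (0 : ℝ)..b, ‖W t‖ ^ 2 = 0 := by exact_mod_cast w3
  by_contra hne
  have := intervalIntegral.integral_pos (a := 0) (b := b) (f := fun t => ‖W t‖ ^ 2) (by positivity)
    (s.cU.norm.pow 2).continuousOn (fun _ _ => by positivity) ⟨x, ⟨hx, by linarith⟩, by positivity⟩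
  linarith

theorem res_uniq {V : ℝ → ℝ} (hV : LocallyIntegrable V volume) (hlp : LimitPointAtTop V)
    {Rz : ℂ → (HH →L[ℂ] HH)}
    (hRz : IsHalfLineResolventFamily V Rz) {z : ℂ} (hz : z.im ≠ 0) {f : HH} {U U' : ℝ → ℂ}
    (s : Sol V z f U U') (w0 : U 0 = 0) (hU : MemLp U 2 mu) : Rz z f =ᵐ[mu] U := by
  obtain ⟨Y, Y', r, y0, e⟩ := res_sol hV hRz hz f
  have c := Sol.comb hV (lp_li f) (lp_li f) s r (-1)
  have n := noeig hV hlp hRz hz (W := fun t => U t + -1 * Y t) (W' := fun t => U' t + -1 * Y' t)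
    (by simpa using c) (by simp [w0, y0])
    (hU.add (((Lp.memLp (Rz z f)).ae_eq e).const_mul (-1)))
  refine e.trans ?_
  filter_upwards [ae_restrict_mem measurableSet_Ioi] with x hx
  linear_combination -n x (le_of_lt hx)

theorem res_id {V : ℝ → ℝ} (hV : LocallyIntegrable V volume) (hlp : LimitPointAtTop V)
    {Rz : ℂ → (HH →L[ℂ] HH)}
    (hRz : IsHalfLineResolventFamily V Rz) {z w : ℂ} (hz : z.im ≠ 0) (hw : w.im ≠ 0) (f : HH) :
    Rz z f - Rz w f = (z - w) • Rz z (Rz w f) := by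
  obtain ⟨U, U', r, u0, e⟩ := res_sol hV hRz hw f
  obtain ⟨Y, Y', s, y0, e2⟩ := res_sol hV hRz hz (Rz w f)
  -- Y solves (H - z) Y = U ; U + (z-w) Y solves (H - z) X = f
  have mU := (Lp.memLp (Rz w f)).ae_eq e
  have mY := (Lp.memLp (Rz z (Rz w f))).ae_eq e2
  have r' := r.shift z
  have c := Sol.comb hV (fun x hx => (lp_li f x hx).add ((r.cU.const_mul (w - z)).intervalIntegrable _ _))
    (lp_li (Rz w f)) r' s (z - w)
  have c2 := Sol.congr (h := f) c (by
    filter_upwards [e] with t ht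
    rw [ht]; ring)
  have u := res_uniq hV hlp hRz hz c2 (by simp [u0, y0]) (mU.add (mY.const_mul (z - w)))
  apply Lp.ext
  filter_upwards [e, e2, u, Lp.coeFn_sub (Rz z f) (Rz w f), Lp.coeFn_smul (z - w) (Rz z (Rz w f))]
    with t h1 h2 h3 h4 h5
  rw [h4, h5, Pi.sub_apply, Pi.smul_apply, h1, h2, h3, smul_eq_mul]; ring
theorem dense_cut : Dense {h : HH | ∃ b : ℝ, 0 ≤ b ∧ ∀ᵐ x ∂mu, b < x → h x = 0} := by
  intro f
  rw [Metric.mem_closure_iff]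
  intro ε hε
  obtain ⟨g, g1, g2, g3, g4⟩ := (Lp.memLp f).exists_hasCompactSupport_eLpNorm_sub_le (by simp)
    (ε := ENNReal.ofReal (ε / 2)) (by simpa using hε)
  refine ⟨g4.toLp, ?_, ?_⟩
  · obtain ⟨r, hr⟩ := g1.isCompact.isBounded.subset_closedBall 0
    refine ⟨max r 0, le_max_right _ _, ?_⟩
    filter_upwards [g4.coeFn_toLp] with x hx hx2
    rw [hx]
    by_contra hne
    have := hr (subset_tsupport g hne)
    rw [Metric.mem_closedBall, dist_zero_right, Real.norm_eq_abs] at this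
    have h1 := le_abs_self x
    have h2 := le_max_left r 0
    linarith
  · have e : f = (Lp.memLp f).toLp := (Lp.toLp_coeFn f _).symm
    rw [dist_eq_norm, e, ← MemLp.toLp_sub, Lp.norm_toLp]
    have := ENNReal.toReal_mono (by simp) g2
    rw [ENNReal.toReal_ofReal (by linarith)] at this
    linarith

theorem inner_cut {b : ℝ} (hb : 0 ≤ b) {f g : HH} {F G : ℝ → ℂ} (hf : f =ᵐ[mu] F) (hg : g =ᵐ[mu] G)
    (h0 : ∀ t, b < t → F t = 0 ∨ G t = 0) :
    inner ℂ f g = ∫ t in (0 : ℝ)..b, star (F t) * G t := by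
  rw [L2.inner_def, intervalIntegral.integral_of_le hb]
  have e1 : ∫ a, inner ℂ (f a) (g a) ∂mu = ∫ a in Set.Ioi 0, star (F a) * G a := by
    apply integral_congr_ae
    filter_upwards [hf, hg] with t h1 h2
    rw [h1, h2, RCLike.inner_apply]; simp [mul_comm]
  rw [e1]
  apply setIntegral_eq_of_subset_of_forall_sdiff_eq_zero measurableSet_Ioi (fun t ht => ht.1)
  rintro t ⟨ht1, ht2⟩
  have : b < t := by
    by_contra H
    exact ht2 ⟨ht1, not_lt.1 H⟩
  rcases h0 t this with h | h <;> simp [h]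

theorem adj_cut {V : ℝ → ℝ} (hV : LocallyIntegrable V volume) (hlp : LimitPointAtTop V)
    {Rz : ℂ → (HH →L[ℂ] HH)}
    (hRz : IsHalfLineResolventFamily V Rz) {z : ℂ} (hz : z.im ≠ 0) {b : ℝ} (hb : 0 ≤ b) {f g : HH}
    {k l : ℝ → ℂ} (hk : Cut b f k) (hl : Cut b g l) :
    inner ℂ (Rz (star z) f) g = inner ℂ f (Rz z g) := by
  have hz' : (star z).im ≠ 0 := by simpa using hz
  obtain ⟨U, U', P', sU, u0, eU, p, p0, y, my⟩ := decomp hV hRz hz' hb hk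
  obtain ⟨W, W', Q', sW, w0, eW, q, q0, x, mx⟩ := decomp hV hRz hz hb hl
  have y' := y.conj
  rw [star_star] at y'
  have sU' := sU.conj
  rw [star_star] at sU'
  simp only [star_zero] at y'
  have w := lp_wr hV hlp hz y' x my.star mx b hb
  simp only [q0 b le_rfl, p0 b le_rfl, sub_zero] at w
  have lk : LI (fun t => star (k t)) := fun x _ => by
    have := hk.ii 0 x
    rw [intervalIntegrable_iff] at this ⊢
    exact memLp_one_iff_integrable.1 (memLp_one_iff_integrable.2 this).star
  have w2 := Sol.wronsk hV lk (fun x _ => hl.ii 0 x) sU' sW hb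
  rw [w, u0, w0] at w2
  simp only [star_zero, zero_mul, mul_zero, sub_zero, zero_add] at w2
  rw [inner_cut hb eU hl.ae fun t ht => Or.inr (hl.zero t ht),
    inner_cut hb hk.ae eW fun t ht => Or.inl (hk.zero t ht)]
  rw [intervalIntegral.integral_sub] at w2
  · exact (sub_eq_zero.1 w2.symm).symm
  · exact (lk b hb).mul_continuousOn sW.cU.continuousOn
  · exact (hl.ii 0 b).continuousOn_mul sU'.cU.continuousOn

theorem adj {V : ℝ → ℝ} (hV : LocallyIntegrable V volume) (hlp : LimitPointAtTop V)
    {Rz : ℂ → (HH →L[ℂ] HH)}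
    (hRz : IsHalfLineResolventFamily V Rz) {z : ℂ} (hz : z.im ≠ 0) (f g : HH) :
    inner ℂ (Rz (star z) f) g = inner ℂ f (Rz z g) := by
  have c1 : ∀ g : HH, IsClosed {f : HH | inner ℂ (Rz (star z) f) g = inner ℂ f (Rz z g)} := fun g =>
    isClosed_eq (by fun_prop) (by fun_prop)
  have c2 : ∀ f : HH, IsClosed {g : HH | inner ℂ (Rz (star z) f) g = inner ℂ f (Rz z g)} := fun f =>
    isClosed_eq (by fun_prop) (by fun_prop)
  have d := dense_cut
  have s1 : ∀ g ∈ {h : HH | ∃ b : ℝ, 0 ≤ b ∧ ∀ᵐ x ∂mu, b < x → h x = 0}, ∀ f : HH,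
      inner ℂ (Rz (star z) f) g = inner ℂ f (Rz z g) := by
    rintro g ⟨b, hb, h0⟩ f
    refine ((c1 g).closure_subset_iff.2 ?_ : closure _ ⊆ _) (d f)
    rintro f ⟨c, hc, h1⟩
    have hm : 0 ≤ max b c := hb.trans (le_max_left _ _)
    refine adj_cut hV hlp hRz hz hm (cut_of hm f ?_) (cut_of hm g ?_)
    · filter_upwards [h1] with x hx h
      exact hx ((le_max_right _ _).trans_lt h)
    · filter_upwards [h0] with x hx h
      exact hx ((le_max_left _ _).trans_lt h)
  exact ((c2 f).closure_subset_iff.2 fun g hg => s1 g hg f : closure _ ⊆ _) (d g)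

theorem res_bd1 {V : ℝ → ℝ} (hV : LocallyIntegrable V volume) (hlp : LimitPointAtTop V)
    {Rz : ℂ → (HH →L[ℂ] HH)}
    (hRz : IsHalfLineResolventFamily V Rz) {z : ℂ} (hz : z.im ≠ 0) (f : HH) :
    2 * |z.im| * ‖Rz (star z) f‖ ^ 2 ≤ ‖f‖ * (‖Rz z f‖ + ‖Rz (star z) f‖) := by
  have hz' : (star z).im ≠ 0 := by simpa using hz
  have h1 := congrArg (fun x => inner ℂ f x) (res_id hV hlp hRz hz hz' f)
  simp only [inner_sub_right, inner_smul_right] at h1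
  rw [← adj hV hlp hRz hz f (Rz (star z) f), inner_self_eq_norm_sq_to_K] at h1
  have h2 := congrArg norm h1
  rw [norm_mul] at h2
  have h3 : ‖z - star z‖ = 2 * |z.im| := by
    have : z - star z = (2 * z.im : ℝ) * Complex.I := by
      have := Complex.sub_conj z
      simpa using this
    rw [this, norm_mul, Complex.norm_real]; simp
  have h4 : ‖((‖Rz (star z) f‖ : ℂ)) ^ 2‖ = ‖Rz (star z) f‖ ^ 2 := by simp
  rw [h3] at h2
  have h5 := norm_sub_le (inner ℂ f (Rz z f)) (inner ℂ f (Rz (star z) f))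
  have h6 := norm_inner_le_norm (𝕜 := ℂ) f (Rz z f)
  have h7 := norm_inner_le_norm (𝕜 := ℂ) f (Rz (star z) f)
  calc _ = _ := by rw [← h4]; rfl
    _ = _ := h2.symm
    _ ≤ _ := by linarith

theorem res_bd {V : ℝ → ℝ} (hV : LocallyIntegrable V volume) (hlp : LimitPointAtTop V)
    {Rz : ℂ → (HH →L[ℂ] HH)}
    (hRz : IsHalfLineResolventFamily V Rz) {z : ℂ} (hz : z.im ≠ 0) (f : HH) :
    ‖Rz z f‖ ≤ 2 * ‖f‖ / |z.im| := by
  have hz' : (star z).im ≠ 0 := by simpa using hz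
  have h1 := res_bd1 hV hlp hRz hz f
  have h2 := res_bd1 hV hlp hRz hz' f
  rw [star_star] at h2
  have e : |(star z).im| = |z.im| := by simp
  rw [e] at h2
  have hp : 0 < |z.im| := abs_pos.2 hz
  rw [le_div_iff₀ hp]
  set n1 := ‖Rz z f‖
  set n2 := ‖Rz (star z) f‖
  have p1 : 0 ≤ n1 := norm_nonneg _
  have p2 : 0 ≤ n2 := norm_nonneg _
  have h3 : |z.im| * (n1 + n2) * (n1 + n2) ≤ 2 * ‖f‖ * (n1 + n2) := by
    nlinarith [mul_nonneg hp.le (sq_nonneg (n1 - n2))]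
  rcases eq_or_lt_of_le (add_nonneg p1 p2) with h | h
  · have : n1 = 0 := by linarith
    rw [this]; simp
  · have := le_of_mul_le_mul_right h3 h
    nlinarith [mul_nonneg hp.le p2]

theorem liou {F : ℂ → ℂ} (hF : Differentiable ℂ F) {C : ℝ} (hC : ∀ z : ℂ, z.im ≠ 0 → ‖F z‖ ≤ C / |z.im|)
    (z : ℂ) : F z = 0 := by
  have C0 : 0 ≤ C := by
    have := hC Complex.I (by simp)
    simp at this
    exact (norm_nonneg _).trans this
  have key : ∀ R : ℝ, ‖z‖ < R → ‖F z‖ * (R ^ 2 - ‖z‖ ^ 2) ≤ 2 * R * C := by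
    intro R hR
    have R0 : 0 < R := (norm_nonneg z).trans_lt hR
    have h := Complex.norm_le_of_forall_mem_frontier_norm_le (f := fun w => F w * (w ^ 2 - (R : ℂ) ^ 2))
      (U := Metric.ball 0 R) (C := 2 * R * C) Metric.isBounded_ball
      (Differentiable.diffContOnCl (by fun_prop)) ?_ (z := z) (subset_closure (by simpa using hR))
    · refine le_trans ?_ h
      rw [norm_mul]
      refine mul_le_mul_of_nonneg_left ?_ (norm_nonneg _)
      have := norm_sub_norm_le ((R : ℂ) ^ 2) (z ^ 2)
      rw [norm_sub_rev (z ^ 2)]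
      simpa using this
    · intro w hw
      rw [frontier_ball _ R0.ne', mem_sphere_zero_iff_norm] at hw
      have e : w ^ 2 - (R : ℂ) ^ 2 = w * ((2 * w.im : ℝ) * Complex.I) := by
        have a1 := Complex.sub_conj w
        have a2 := Complex.mul_conj' w
        rw [hw] at a2
        rw [← a1, ← a2]; ring
      have e2 : ‖w ^ 2 - (R : ℂ) ^ 2‖ = 2 * R * |w.im| := by
        rw [e, norm_mul, norm_mul, Complex.norm_real, hw]; simp; ring
      rw [norm_mul, e2]
      by_cases h0 : w.im = 0
      · rw [h0]; simp; positivity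
      · have hp : 0 < |w.im| := abs_pos.2 h0
        have := hC w h0
        rw [le_div_iff₀ hp] at this
        nlinarith
  by_contra hne
  have ha : 0 < ‖F z‖ := norm_pos_iff.2 hne
  set a := ‖F z‖
  set r := ‖z‖
  have r0 : 0 ≤ r := norm_nonneg z
  have q : 0 ≤ 2 * C / a := by positivity
  have hk := key (r + 1 + 2 * C / a) (by linarith)
  have e : a * (2 * C / a) = 2 * C := by field_simp
  set t := 2 * C / a
  nlinarith [mul_nonneg ha.le r0, mul_nonneg q r0, mul_nonneg (mul_nonneg q r0) ha.le, mul_nonneg ha.le q]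
theorem ae_zero_of_int {f : ℝ → ℂ} (hf : LI f) (h : ∀ x, 0 ≤ x → ∫ t in (0 : ℝ)..x, f t = 0) :
    f =ᵐ[mu] 0 := by
  have h1 : ∀ᵐ x, ∀ n : ℕ, x ∈ Set.uIcc (0 : ℝ) n → ∀ c ∈ Set.uIcc (0 : ℝ) n,
      HasDerivAt (fun y => ∫ t in c..y, f t) (f x) x := by
    rw [ae_all_iff]
    intro n
    exact (hf n n.cast_nonneg).ae_hasDerivAt_integral
  filter_upwards [ae_restrict_of_ae h1, ae_restrict_mem measurableSet_Ioi] with x hx hx0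
  have hx0 : 0 < x := hx0
  obtain ⟨n, hn⟩ := exists_nat_gt x
  have a := hx n (by rw [Set.uIcc_of_le n.cast_nonneg]; exact ⟨hx0.le, hn.le⟩) 0 (by simp)
  have b : HasDerivAt (fun y => ∫ t in (0 : ℝ)..y, f t) 0 x := by
    refine (hasDerivAt_const x (0 : ℂ)).congr_of_eventuallyEq ?_
    filter_upwards [lt_mem_nhds hx0] with y hy
    exact h y hy.le
  exact a.unique b

theorem res_inj {V : ℝ → ℝ} (hV : LocallyIntegrable V volume) {Rz : ℂ → (HH →L[ℂ] HH)}
    (hRz : IsHalfLineResolventFamily V Rz) {z : ℂ} (hz : z.im ≠ 0) (f : HH) (h : Rz z f = 0) : f = 0 := by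
  obtain ⟨U, U', s, u0, e⟩ := res_sol hV hRz hz f
  rw [h] at e
  have U0 := ae_ici s.cU (e.symm.trans (Lp.coeFn_zero _ _ _))
  have U0' : ∀ x, 0 ≤ x → U' x = 0 := by
    apply eq_ici s.cU'
    intro x hx
    refine (s.hasDerivAt hx).unique ?_
    refine (hasDerivAt_const x (0 : ℂ)).congr_of_eventuallyEq ?_
    filter_upwards [lt_mem_nhds hx] with y hy
    exact U0 y hy.le
  have : f =ᵐ[mu] 0 := by
    apply ae_zero_of_int (lp_li f)
    intro x hx
    have e := s.eU' x hx
    rw [U0' x hx, U0' 0 le_rfl, zero_add] at e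
    have e2 : ∫ t in (0 : ℝ)..x, (((V t : ℂ) - z) * U t - f t) = ∫ t in (0 : ℝ)..x, - f t := by
      apply intervalIntegral.integral_congr
      intro t ht
      rw [Set.uIcc_of_le hx] at ht
      simp [U0 t ht.1]
    rw [e2, intervalIntegral.integral_neg] at e
    exact neg_eq_zero.1 e.symm
  exact (Lp.eq_zero_iff_ae_eq_zero).2 this

theorem func_ex {b : ℝ} (hb : 0 ≤ b) {k : ℝ → ℂ} (hk : IntervalIntegrable k volume 0 b) (c : ℂ) :
    ∃ L : C(Set.Icc 0 b, ℂ) →L[ℂ] ℂ, ∀ q, L q = (∫ t in (0 : ℝ)..b, k t * ext hb q t) - c * ext hb q 0 := by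
  have ii : ∀ q : C(Set.Icc 0 b, ℂ), IntervalIntegrable (fun t => k t * ext hb q t) volume 0 b := fun q =>
    hk.mul_continuousOn (ext_cont hb q).continuousOn
  refine ⟨LinearMap.mkContinuous
    { toFun := fun q => (∫ t in (0 : ℝ)..b, k t * ext hb q t) - c * ext hb q 0
      map_add' := ?_
      map_smul' := ?_ } ((∫ t in (0 : ℝ)..b, ‖k t‖) + ‖c‖) ?_, fun q => rfl⟩
  · intro p q
    have : ∀ t, ext hb (p + q) t = ext hb p t + ext hb q t := fun t => rfl
    simp only [this, mul_add]
    rw [intervalIntegral.integral_add (ii p) (ii q)]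
    ring
  · intro r q
    have : ∀ t, ext hb (r • q) t = r * ext hb q t := fun t => rfl
    simp only [this, RingHom.id_apply, smul_eq_mul, mul_sub, ← intervalIntegral.integral_const_mul]
    congr 1
    · congr 1; funext t; ring
    · ring
  · intro q
    change ‖(∫ t in (0 : ℝ)..b, k t * ext hb q t) - c * ext hb q 0‖ ≤ _
    refine (norm_sub_le _ _).trans ?_
    rw [add_mul]
    refine add_le_add ?_ ?_
    · refine (intervalIntegral.norm_integral_le_integral_norm hb).trans ?_
      rw [← intervalIntegral.integral_mul_const]
      refine intervalIntegral.integral_mono_on hb (ii q).norm (hk.norm.mul_const _) fun t _ => ?_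
      rw [norm_mul]
      exact mul_le_mul_of_nonneg_left (ext_le hb q t) (norm_nonneg _)
    · rw [norm_mul]
      exact mul_le_mul_of_nonneg_left (ext_le hb q 0) (norm_nonneg _)

theorem main_cut {V : ℝ → ℝ} (hV : LocallyIntegrable V volume) (hlp : LimitPointAtTop V)
    {Rz : ℂ → (HH →L[ℂ] HH)}
    (hRz : IsHalfLineResolventFamily V Rz) {Φ Φ' : ℝ → ℂ} (sΦ : Sol V Complex.I (fun _ => 0) Φ Φ')
    (p0 : Φ 0 ≠ 0) (φL : HH) (hφ : φL =ᵐ[mu] Φ) (ψ : HH)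
    (hψ : ∀ z : ℂ, z.im ≠ 0 → inner ℂ ψ (Rz z φL) = 0) {b : ℝ} (hb : 0 ≤ b) {h : HH} {k : ℝ → ℂ}
    (hk : Cut b h k) (z : ℂ) (hz : z.im ≠ 0) : inner ℂ ψ (Rz z h) = 0 := by
  have lψ : LI (fun t => star (ψ t)) := memLp_li (Lp.memLp ψ).star
  obtain ⟨L, hL⟩ := func_ex hb (lψ b hb) (inner ℂ ψ φL / Φ 0)
  have key : ∀ z : ℂ, z.im ≠ 0 → inner ℂ ψ (Rz z h) = L (qz hb hV k hk.ii z) := by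
    intro z hz
    obtain ⟨U, U', Q', sU, u0, eU, q, q0, y, my⟩ := decomp hV hRz hz hb hk
    obtain ⟨W, W', sW, w0, eW⟩ := res_sol hV hRz hz φL
    set Q := ext hb (qz hb hV k hk.ii z) with hQ
    have mQ : MemLp Q 2 mu := ext_memLp hb _ fun x hx => (q0 x hx).1
    have mΦ : MemLp Φ 2 mu := (Lp.memLp φL).ae_eq hφ
    have mW : MemLp W 2 mu := (Lp.memLp (Rz z φL)).ae_eq eW
    have x1 := Sol.comb hV (fun x _ => (intervalIntegrable_const (c := (0 : ℂ))).add
      ((sΦ.cU.const_mul (Complex.I - z)).intervalIntegrable _ _)) (lp_li φL) (sΦ.shift z) sW (-(Complex.I - z))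
    have x2 := Sol.congr (h := fun _ => 0) x1 (by
      filter_upwards [hφ] with t ht
      rw [ht]; ring)
    obtain ⟨c, d, hcd, H⟩ := lp_pair hV hlp hz y x2 my (mΦ.add (mW.const_mul _))
    have H0 := (H 0 le_rfl).1
    simp only [u0, w0, mul_zero, add_zero, zero_sub] at H0
    have hc : c ≠ 0 := by
      rintro rfl
      have : d = 0 := by simpa [p0] using H0
      exact hcd (by rw [this]; rfl)
    have hd : d / c = Q 0 / Φ 0 := by
      rw [div_eq_div_iff hc p0]; linear_combination H0
    have eq : Rz z h = mQ.toLp - (Q 0 / Φ 0) • (φL - (Complex.I - z) • Rz z φL) := by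
      apply Lp.ext
      have a1 := Lp.coeFn_sub mQ.toLp ((Q 0 / Φ 0) • (φL - (Complex.I - z) • Rz z φL))
      have a2 := Lp.coeFn_smul (Q 0 / Φ 0) (φL - (Complex.I - z) • Rz z φL)
      have a3 := Lp.coeFn_sub φL ((Complex.I - z) • Rz z φL)
      have a4 := Lp.coeFn_smul (Complex.I - z) (Rz z φL)
      filter_upwards [a1, a2, a3, a4, eU, eW, hφ, mQ.coeFn_toLp, ae_restrict_mem measurableSet_Ioi]
        with t b1 b2 b3 b4 b5 b6 b7 b8 b9
      have Ht := (H t (le_of_lt b9)).1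
      rw [b1, Pi.sub_apply, b2, Pi.smul_apply, b3, Pi.sub_apply, b4, Pi.smul_apply, b5, b6, b7, b8, ← hd]
      simp only [smul_eq_mul]
      apply mul_left_cancel₀ hc
      have : c * (d / c) = d := by field_simp
      linear_combination Ht + (Φ t - (Complex.I - z) * W t) * this
    rw [eq, inner_sub_right, inner_smul_right, inner_sub_right, inner_smul_right, hψ z hz, hL,
      inner_cut hb (Filter.EventuallyEq.refl _ _) mQ.coeFn_toLp fun t ht => Or.inr (q0 t ht.le).1]
    ring
  rw [key z hz]
  refine liou (F := fun z => L (qz hb hV k hk.ii z)) (L.differentiable.comp (qz_diff hb hV k hk.ii))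
    (C := 2 * ‖ψ‖ * ‖h‖) (fun w hw => ?_) z
  rw [← key w hw]
  refine (norm_inner_le_norm _ _).trans ?_
  refine (mul_le_mul_of_nonneg_left (res_bd hV hlp hRz hw h) (norm_nonneg _)).trans (le_of_eq ?_)
  ring

/-- The Weyl solution `φ` at spectral parameter `i` (the solution of `−φ'' + Vφ = iφ` which
is `L²` at `+∞`) is a cyclic vector for the half-line Dirichlet operator `H₁`, cyclicity
being via the resolvent orbit `{(H₁ − z)⁻¹ φ : z ∈ ℂ ∖ ℝ}`. -/
theorem weyl_solution_cyclic_for_halfline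
    (V : ℝ → ℝ) (hV : LocallyIntegrable V volume) (hlp : LimitPointAtTop V)
    (Rz : ℂ → (Lp ℂ 2 ((volume : Measure ℝ).restrict (Set.Ioi 0)) →L[ℂ]
      Lp ℂ 2 ((volume : Measure ℝ).restrict (Set.Ioi 0))))
    (hRz : IsHalfLineResolventFamily V Rz)
    (φ φ' : ℝ → ℂ) (hφsol : IsSolOn V Complex.I φ φ' (Set.Ioi 0) 1)
    (hφL2 : IntegrableOn (fun x => ‖φ x‖ ^ 2) (Set.Ioi 1) volume)
    (hφne : ∃ x ∈ Set.Ioi (0 : ℝ), φ x ≠ 0)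
    (φL : Lp ℂ 2 ((volume : Measure ℝ).restrict (Set.Ioi 0)))
    (hφL : (φL : ℝ → ℂ) =ᵐ[(volume : Measure ℝ).restrict (Set.Ioi 0)] φ) :
    (Submodule.span ℂ
      (Set.range fun z : {z : ℂ // z.im ≠ 0} => (Rz z.1) φL)).topologicalClosure = ⊤ := by
  obtain ⟨Φ, Φ', sΦ, e1, -⟩ := sol_of hV li_zero hφsol
  have hφ : φL =ᵐ[mu] Φ := by
    refine hφL.trans ?_
    filter_upwards [ae_restrict_mem measurableSet_Ioi] with x hx
    exact e1 x hx
  have hI : Complex.I.im ≠ 0 := by simp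
  have p0 : Φ 0 ≠ 0 := by
    intro h0
    obtain ⟨x, hx, hne⟩ := hφne
    apply hne
    rw [e1 x hx]
    exact noeig hV hlp hRz hI sΦ h0 ((Lp.memLp φL).ae_eq hφ) x (le_of_lt hx)
  rw [Submodule.topologicalClosure_eq_top_iff, Submodule.eq_bot_iff]
  intro ψ hψ
  rw [Submodule.mem_orthogonal'] at hψ
  have hψ' : ∀ z : ℂ, z.im ≠ 0 → inner ℂ ψ (Rz z φL) = 0 := fun z hz =>
    hψ _ (Submodule.subset_span ⟨⟨z, hz⟩, rfl⟩)
  have all : ∀ h : HH, inner ℂ ψ (Rz Complex.I h) = 0 := by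
    intro h
    have hc : IsClosed {h : HH | inner ℂ ψ (Rz Complex.I h) = 0} :=
      isClosed_eq (by fun_prop) continuous_const
    refine (hc.closure_subset_iff.2 ?_ : closure _ ⊆ _) (dense_cut h)
    rintro h ⟨b, hb, h0⟩
    exact main_cut hV hlp hRz sΦ p0 φL hφ ψ hψ' hb (cut_of hb h h0) Complex.I hI
  have hI' : (star Complex.I).im ≠ 0 := by simp
  apply res_inj hV hRz hI'
  rw [← inner_self_eq_zero (𝕜 := ℂ), adj hV hlp hRz hI]
  exact all _
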